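/- Let M be an unmixed finitely generated module of dimension d over a local ring A (quotient of a Gorenstein local ring) not satisfying S_2, and set M' = D^d(D^d(M)). If K_M = D^d(M) is Cohen–Macaulay, then H^{i-1}_m(M'/M) ≅ H^i_m(M) for i = 1, ..., d−1; in particular depth(M'/M) = depth(M) − 1 and dim(M'/M) = max{ i ≤ d−2 : H^{i+1}_m(M) ≠ 0 }. -/

import Mathlib

open CategoryTheory

noncomputable section

/-- The dimension of a module: Krull dimension of its support. -/
def moduleDim (R : Type) [CommRing R] (M : Type) [AddCommGroup M] [Module R M] :
    WithBot (WithTop ℕ) :=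
  Order.krullDim (Module.support R M)

/-- The depth of a module over a local ring: supremum of lengths of regular
sequences on `M` contained in the maximal ideal. -/
def moduleDepth (R : Type) [CommRing R] [IsLocalRing R] (M : Type) [AddCommGroup M]
    [Module R M] : ℕ∞ :=
  sSup {n : ℕ∞ | ∃ rs : List R, (rs.length : ℕ∞) = n ∧
    (∀ r ∈ rs, r ∈ IsLocalRing.maximalIdeal R) ∧ RingTheory.Sequence.IsRegular M rs}

/-- A module over a local ring is Cohen–Macaulay if it is zero or its depth
equals its (Krull) dimension. -/
def IsCM (R : Type) [CommRing R] [IsLocalRing R] (M : Type) [AddCommGroup M]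
    [Module R M] : Prop :=
  Subsingleton M ∨ moduleDim R M = (moduleDepth R M : WithBot ℕ∞)

/-- `extModule R n M N` is `Ext_R^n(M, N)` as an `R`-module object. -/
def extModule (R : Type) [CommRing R] (n : ℕ) (M N : Type) [AddCommGroup M] [Module R M]
    [AddCommGroup N] [Module R N] : ModuleCat R :=
  ((Ext R (ModuleCat R) n).obj (Opposite.op (ModuleCat.of R M))).obj (ModuleCat.of R N)

/-- A Noetherian local ring `R` of dimension `n` is Gorenstein if
`Ext^i(k, R)` vanishes for `i ≠ n` and is isomorphic to the residue field `k` for `i = n`. -/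
def IsGorensteinLocalRing (R : Type) [CommRing R] [IsLocalRing R] : Prop :=
  IsNoetherianRing R ∧
  ∀ n : ℕ, ringKrullDim R = n →
    (∀ i : ℕ, i ≠ n → Subsingleton ↥(extModule R i (IsLocalRing.ResidueField R) R)) ∧
    Nonempty (extModule R n (IsLocalRing.ResidueField R) R ≅
      ModuleCat.of R (IsLocalRing.ResidueField R))

/-- Serre's condition `S_k` (here `k = 2`): `depth M_P ≥ min(2, dim M_P)` for all primes. -/
def SerreS2 (R : Type) [CommRing R] (M : Type) [AddCommGroup M] [Module R M] : Prop :=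
  ∀ (P : Ideal R) [P.IsPrime],
    min 2 (moduleDim (Localization.AtPrime P) (LocalizedModule P.primeCompl M)) ≤
      ((moduleDepth (Localization.AtPrime P) (LocalizedModule P.primeCompl M) : ℕ∞) :
        WithBot ℕ∞)

/-- A module is unmixed if all its associated primes have the same dimension, `dim M`. -/
def IsUnmixed (A : Type) [CommRing A] (M : Type) [AddCommGroup M] [Module A M] : Prop :=
  ∀ P ∈ associatedPrimes A M, ringKrullDim (A ⧸ P) = moduleDim A M

noncomputable section

section Bridge

open Limits Opposite

variable {R : Type} [CommRing R]

lemma extMk_zero_eq_zero {X Y : ModuleCat.{0} R} (P : ProjectiveResolution X)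
    (f : P.complex.X 0 ⟶ Y) (hf : P.complex.d 1 0 ≫ f = 0)
    (h : P.extMk f 1 rfl hf = 0) : f = 0 := by
  simp only [← P.extEquivCohomologyClass.apply_eq_iff_eq,
    ProjectiveResolution.extEquivCohomologyClass_extMk,
    ProjectiveResolution.extEquivCohomologyClass_zero,
    CochainComplex.HomComplex.CohomologyClass.mk_eq_zero_iff] at h
  rw [CochainComplex.HomComplex.Cocycle.toSingleMk_mem_coboundaries_iff _ _ _ _ _ (1) (by simp)] at h
  obtain ⟨g, hg⟩ := h
  have hz : IsZero (P.cochainComplex.X 1) :=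
    CochainComplex.isZero_of_isStrictlyLE _ 0 1 (by lia)
  have : g = 0 := hz.eq_of_src _ _
  rw [this, comp_zero] at hg
  rw [← cancel_epi (P.cochainComplexXIso (-(0:ℕ)) 0 rfl).hom, ← hg, comp_zero]

lemma unop_congr_apply {A B : (ModuleCat.{0} R)ᵒᵖ} {f g : A ⟶ B} (h : f = g) (z : B.unop) :
    f.unop.hom z = g.unop.hom z := by rw [h]

abbrev yF (Y : ModuleCat.{0} R) : ModuleCat.{0} R ⥤ (ModuleCat.{0} R)ᵒᵖ :=
  ((linearYoneda R (ModuleCat.{0} R)).obj Y).rightOp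

abbrev yK {X : ModuleCat.{0} R} (P : ProjectiveResolution X) (Y : ModuleCat.{0} R) :
    ChainComplex (ModuleCat.{0} R)ᵒᵖ ℕ :=
  ((yF Y).mapHomologicalComplex _).obj P.complex

/-- cocycle projection -/
def yq {X : ModuleCat.{0} R} (P : ProjectiveResolution X) (Y : ModuleCat.{0} R) (n : ℕ) :
    ((yK P Y).opcycles n).unop ⟶ ((yK P Y).homology n).unop :=
  ((yK P Y).homologyι n).unop

def yι {X : ModuleCat.{0} R} (P : ProjectiveResolution X) (Y : ModuleCat.{0} R) (n : ℕ) :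
    ((yK P Y).opcycles n).unop →ₗ[R] (P.complex.X n ⟶ Y) :=
  ((yK P Y).pOpcycles n).unop.hom

lemma yq_surj {X : ModuleCat.{0} R} (P : ProjectiveResolution X) (Y : ModuleCat.{0} R) (n : ℕ) :
    Function.Surjective (yq P Y n) := by
  rw [← ModuleCat.epi_iff_surjective]
  unfold yq
  infer_instance

lemma yι_inj {X : ModuleCat.{0} R} (P : ProjectiveResolution X) (Y : ModuleCat.{0} R) (n : ℕ) :
    Function.Injective (yι P Y n) := by
  have : Mono ((yK P Y).pOpcycles n).unop := inferInstance
  exact (ModuleCat.mono_iff_injective _).1 this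

lemma yι_range {X : ModuleCat.{0} R} (P : ProjectiveResolution X) (Y : ModuleCat.{0} R) (n : ℕ)
    (f : P.complex.X n ⟶ Y) :
    (∃ z, yι P Y n z = f) ↔ P.complex.d (n+1) n ≫ f = 0 := by
  have h := (ShortComplex.exact_of_g_is_cokernel
    (ShortComplex.mk _ _ ((yK P Y).d_pOpcycles (n+1) n))
    ((yK P Y).opcyclesIsCokernel (n+1) n (by simp))).unop
  rw [ShortComplex.moduleCat_exact_iff_range_eq_ker] at h
  have h2 := SetLike.ext_iff.1 h f
  exact h2

lemma yq_ker {X : ModuleCat.{0} R} (P : ProjectiveResolution X) (Y : ModuleCat.{0} R) (n p : ℕ)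
    (hp : (ComplexShape.down ℕ).next n = p)
    (z : ((yK P Y).opcycles n).unop) :
    yq P Y n z = 0 ↔ ∃ g : P.complex.X p ⟶ Y, P.complex.d n p ≫ g = yι P Y n z := by
  have h := (ShortComplex.exact_of_f_is_kernel
    (ShortComplex.mk _ _ ((yK P Y).homologyι_comp_fromOpcycles n p))
    ((yK P Y).homologyIsKernel n p hp)).unop
  rw [ShortComplex.moduleCat_exact_iff_range_eq_ker] at h
  have h2 := SetLike.ext_iff.1 h z
  refine h2.symm.trans ?_
  have h3 : ∀ g : P.complex.X p ⟶ Y,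
      yι P Y n (((yK P Y).fromOpcycles n p).unop g) = P.complex.d n p ≫ g := by
    intro g
    exact unop_congr_apply ((yK P Y).p_fromOpcycles n p) g
  constructor
  · rintro ⟨g, hg⟩
    refine ⟨g, ?_⟩
    rw [← hg]; exact (h3 g).symm
  · rintro ⟨g, hg⟩
    refine ⟨g, ?_⟩
    apply yι_inj
    rw [← hg]; exact (h3 g)

def yΨ {X : ModuleCat.{0} R} (P : ProjectiveResolution X) (Y : ModuleCat.{0} R) (n : ℕ) :
    ((yK P Y).opcycles n).unop →ₗ[R] Abelian.Ext X Y n where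
  toFun z := P.extMk (yι P Y n z) (n+1) rfl ((yι_range P Y n _).1 ⟨z, rfl⟩)
  map_add' a b := by
    rw [P.add_extMk]; congr 1; simp
  map_smul' r a := by
    rw [RingHom.id_apply, Abelian.Ext.smul_eq_comp_mk₀, P.extMk_comp_mk₀]
    congr 1
    simp

lemma yΨ_surj {X : ModuleCat.{0} R} (P : ProjectiveResolution X) (Y : ModuleCat.{0} R) (n : ℕ) :
    Function.Surjective (yΨ P Y n) := by
  intro α
  obtain ⟨f, hf, rfl⟩ := P.extMk_surjective α (n+1) rfl
  obtain ⟨z, rfl⟩ := (yι_range P Y n f).2 hf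
  exact ⟨z, rfl⟩

lemma yΨ_ker {X : ModuleCat.{0} R} (P : ProjectiveResolution X) (Y : ModuleCat.{0} R) (n : ℕ)
    (z : ((yK P Y).opcycles n).unop) :
    yΨ P Y n z = 0 ↔ yq P Y n z = 0 := by
  rcases n with _ | n
  · rw [yq_ker P Y 0 0 (by simp)]
    constructor
    · intro h
      have := extMk_zero_eq_zero P (yι P Y 0 z) ((yι_range P Y 0 _).1 ⟨z, rfl⟩) h
      exact ⟨0, by rw [this]; simp⟩
    · rintro ⟨g, hg⟩
      have : yι P Y 0 z = 0 := by rw [← hg]; simp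
      have : z = 0 := yι_inj P Y 0 (by rw [this, map_zero])
      rw [this, map_zero]
  · rw [yq_ker P Y (n+1) n (by simp)]
    exact P.extMk_eq_zero_iff (yι P Y (n+1) z) (n+1+1) rfl ((yι_range P Y (n+1) _).1 ⟨z, rfl⟩) n rfl

lemma exists_bridge (Y : ModuleCat.{0} R) (n : ℕ) :
    ∃ e : ∀ X : ModuleCat.{0} R, ((Ext R (ModuleCat.{0} R) n).obj (op X)).obj Y ≃ₗ[R]
      Abelian.Ext X Y n, ∀ (X X' : ModuleCat.{0} R) (f : X' ⟶ X)
        (x : ((Ext R (ModuleCat.{0} R) n).obj (op X)).obj Y),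
        e X' (((Ext R (ModuleCat.{0} R) n).map f.op).app Y x) =
          (Abelian.Ext.mk₀ f).comp (e X x) (zero_add n) := by
  have key : ∀ X : ModuleCat.{0} R, ∃ e : ((Ext R (ModuleCat.{0} R) n).obj (op X)).obj Y ≃ₗ[R]
      Abelian.Ext X Y n, ∀ z, e (((projectiveResolution X).isoLeftDerivedObj (yF Y) n).hom.unop
        (yq (projectiveResolution X) Y n z)) = yΨ (projectiveResolution X) Y n z := by
    intro X
    set P := projectiveResolution X
    let i := (P.isoLeftDerivedObj (yF Y) n).unop.toLinearEquiv
    let q' : ((yK P Y).opcycles n).unop →ₗ[R]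
      ((Ext R (ModuleCat.{0} R) n).obj (op X)).obj Y := i.toLinearMap ∘ₗ (yq P Y n).hom
    have hq' : Function.Surjective q' := i.surjective.comp (yq_surj P Y n)
    have hk : LinearMap.ker q' = LinearMap.ker (yΨ P Y n) := by
      ext z
      rw [LinearMap.mem_ker, LinearMap.mem_ker, yΨ_ker]
      exact i.map_eq_zero_iff
    refine ⟨(q'.quotKerEquivOfSurjective hq').symm.trans
      ((Submodule.quotEquivOfEq _ _ hk).trans
        ((yΨ P Y n).quotKerEquivOfSurjective (yΨ_surj P Y n))), fun z => ?_⟩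
    have h1 : (q'.quotKerEquivOfSurjective hq').symm (q' z) = Submodule.Quotient.mk z := by
      rw [LinearEquiv.symm_apply_eq]; rfl
    change (Submodule.quotEquivOfEq _ _ hk).trans
        ((yΨ P Y n).quotKerEquivOfSurjective (yΨ_surj P Y n))
        ((q'.quotKerEquivOfSurjective hq').symm (q' z)) = _
    rw [h1]
    rfl
  choose e he using key
  refine ⟨e, fun X X' f x => ?_⟩
  set P := projectiveResolution X with hP
  set P' := projectiveResolution X' with hP'
  obtain ⟨z, rfl⟩ : ∃ z, (P.isoLeftDerivedObj (yF Y) n).hom.unop (yq P Y n z) = x := by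
    have : Function.Surjective (P.isoLeftDerivedObj (yF Y) n).hom.unop :=
      (P.isoLeftDerivedObj (yF Y) n).unop.toLinearEquiv.surjective
    obtain ⟨y, rfl⟩ := this x
    obtain ⟨z, rfl⟩ := yq_surj P Y n y
    exact ⟨z, rfl⟩
  rw [he]
  let φ0 : P'.complex ⟶ P.complex := ProjectiveResolution.lift f P' P
  let φ : ProjectiveResolution.Hom P' P f := ⟨φ0, by
    have := ProjectiveResolution.lift_commutes f P' P
    exact congrArg (fun t => t.f 0) this⟩
  have hcomm : φ0.f 0 ≫ P.π.f 0 = P'.π.f 0 ≫ f := by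
    have := φ.hom_f_zero_comp_π_f_zero
    rw [ChainComplex.single₀_map_f_zero] at this
    exact this
  have nat := ProjectiveResolution.isoLeftDerivedObj_hom_naturality f P' P φ0 hcomm (yF Y) n
  let ψ : yK P' Y ⟶ yK P Y := ((yF Y).mapHomologicalComplex _).map φ0
  have nat2 := HomologicalComplex.homologyι_naturality ψ n
  have nat3 := HomologicalComplex.p_opcyclesMap ψ n
  let z' : ((yK P' Y).opcycles n).unop := (HomologicalComplex.opcyclesMap ψ n).unop z
  have e1 : ((Ext R (ModuleCat.{0} R) n).map f.op).app Y
      ((P.isoLeftDerivedObj (yF Y) n).hom.unop (yq P Y n z)) =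
      (P'.isoLeftDerivedObj (yF Y) n).hom.unop (yq P' Y n z') := by
    have a1 := unop_congr_apply nat (yq P Y n z)
    have a2 := unop_congr_apply nat2 z
    refine a1.trans ?_
    exact congrArg (P'.isoLeftDerivedObj (yF Y) n).hom.unop a2
  have e2 : yι P' Y n z' = φ0.f n ≫ yι P Y n z :=
    unop_congr_apply nat3 z
  rw [e1, he]
  have := ProjectiveResolution.mk₀_comp_extMk (yι P Y n z) (n+1) rfl
    ((yι_range P Y n _).1 ⟨z, rfl⟩) φ
  refine Eq.trans ?_ this.symm
  change P'.extMk (yι P' Y n z') (n+1) rfl ((yι_range P' Y n _).1 ⟨z', rfl⟩) = _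
  congr 1

end Bridge
end

noncomputable section

section ExtBasics

open Opposite IsLocalRing

variable {R : Type} [CommRing R]

abbrev EE (R : Type) [CommRing R] (X Y : Type) [AddCommGroup X] [Module R X]
    [AddCommGroup Y] [Module R Y] (j : ℕ) : Type :=
  Abelian.Ext (ModuleCat.of R X) (ModuleCat.of R Y) j

variable {X Y Z N L : Type} [AddCommGroup X] [Module R X] [AddCommGroup Y] [Module R Y]
  [AddCommGroup Z] [Module R Z] [AddCommGroup N] [Module R N] [AddCommGroup L] [Module R L]

/-- short complex from linear maps -/
abbrev sC (f : X →ₗ[R] Y) (g : Y →ₗ[R] Z) (h : Function.Exact f g) :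
    ShortComplex (ModuleCat.{0} R) :=
  ShortComplex.mk (ModuleCat.ofHom f) (ModuleCat.ofHom g) (by
    ext x; exact (h (f x)).2 ⟨x, rfl⟩)

lemma sC_exact (f : X →ₗ[R] Y) (g : Y →ₗ[R] Z) (h : Function.Exact f g)
    (hf : Function.Injective f) (hg : Function.Surjective g) : (sC f g h).ShortExact :=
  ModuleCat.shortComplex_shortExact _ h hf hg

lemma Ext_subsingleton_iff {X Y : ModuleCat.{0} R} {j : ℕ} :
    Subsingleton (Abelian.Ext X Y j) ↔ ∀ a : Abelian.Ext X Y j, a = 0 :=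
  ⟨fun _ a => Subsingleton.elim _ _, fun h => ⟨fun a b => by rw [h a, h b]⟩⟩

section LES
variable {S : ShortComplex (ModuleCat.{0} R)} (hS : S.ShortExact) (W : ModuleCat.{0} R)

include hS

lemma contra_mid {j : ℕ} (h1 : Subsingleton (Abelian.Ext S.X₁ W j))
    (h3 : Subsingleton (Abelian.Ext S.X₃ W j)) : Subsingleton (Abelian.Ext S.X₂ W j) := by
  rw [Ext_subsingleton_iff]; intro a
  obtain ⟨b, rfl⟩ := Abelian.Ext.contravariant_sequence_exact₂ hS W a (Subsingleton.elim _ _)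
  rw [Subsingleton.elim b 0]; simp

lemma contra_right {j : ℕ} (h1 : Subsingleton (Abelian.Ext S.X₁ W j))
    (h2 : Subsingleton (Abelian.Ext S.X₂ W (j+1))) : Subsingleton (Abelian.Ext S.X₃ W (j+1)) := by
  rw [Ext_subsingleton_iff]; intro a
  obtain ⟨b, rfl⟩ := Abelian.Ext.contravariant_sequence_exact₃ hS W a (Subsingleton.elim _ _)
    (Nat.add_comm 1 j)
  rw [Subsingleton.elim b 0]; simp

lemma contra_left {j : ℕ} (h2 : Subsingleton (Abelian.Ext S.X₂ W j))
    (h3 : Subsingleton (Abelian.Ext S.X₃ W (j+1))) : Subsingleton (Abelian.Ext S.X₁ W j) := by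
  rw [Ext_subsingleton_iff]; intro a
  obtain ⟨b, rfl⟩ := Abelian.Ext.contravariant_sequence_exact₁ hS W a
    (Nat.add_comm 1 j) (Subsingleton.elim _ _)
  rw [Subsingleton.elim b 0]; simp

lemma co_mid {j : ℕ} (h1 : Subsingleton (Abelian.Ext W S.X₁ j))
    (h3 : Subsingleton (Abelian.Ext W S.X₃ j)) : Subsingleton (Abelian.Ext W S.X₂ j) := by
  rw [Ext_subsingleton_iff]; intro a
  obtain ⟨b, rfl⟩ := Abelian.Ext.covariant_sequence_exact₂ W hS a (Subsingleton.elim _ _)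
  rw [Subsingleton.elim b 0]; simp

lemma co_right {j : ℕ} (h2 : Subsingleton (Abelian.Ext W S.X₂ j))
    (h1 : Subsingleton (Abelian.Ext W S.X₁ (j+1))) : Subsingleton (Abelian.Ext W S.X₃ j) := by
  rw [Ext_subsingleton_iff]; intro a
  obtain ⟨b, rfl⟩ := Abelian.Ext.covariant_sequence_exact₃ W hS a rfl (Subsingleton.elim _ _)
  rw [Subsingleton.elim b 0]; simp

lemma co_left {j : ℕ} (h3 : Subsingleton (Abelian.Ext W S.X₃ j))
    (h2 : Subsingleton (Abelian.Ext W S.X₂ (j+1))) : Subsingleton (Abelian.Ext W S.X₁ (j+1)) := by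
  rw [Ext_subsingleton_iff]; intro a
  obtain ⟨b, rfl⟩ := Abelian.Ext.covariant_sequence_exact₁ W hS a (Subsingleton.elim _ _) rfl
  rw [Subsingleton.elim b 0]; simp

end LES

/-- covariant and contravariant isomorphisms -/
def extIsoLeft {X X' : ModuleCat.{0} R} (e : X ≅ X') (Y : ModuleCat.{0} R) (j : ℕ) :
    Abelian.Ext X' Y j ≃ₗ[R] Abelian.Ext X Y j where
  toFun a := (Abelian.Ext.mk₀ e.hom).comp a (zero_add j)
  invFun a := (Abelian.Ext.mk₀ e.inv).comp a (zero_add j)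
  map_add' a b := by simp
  map_smul' r a := by simp [Abelian.Ext.comp_smul]
  left_inv a := by simp
  right_inv a := by simp

def extIsoRight (X : ModuleCat.{0} R) {Y Y' : ModuleCat.{0} R} (e : Y ≅ Y') (j : ℕ) :
    Abelian.Ext X Y j ≃ₗ[R] Abelian.Ext X Y' j where
  toFun a := a.comp (Abelian.Ext.mk₀ e.hom) (add_zero j)
  invFun a := a.comp (Abelian.Ext.mk₀ e.inv) (add_zero j)
  map_add' a b := by simp
  map_smul' r a := by simp [Abelian.Ext.smul_comp]
  left_inv a := by simp [Abelian.Ext.comp_assoc_of_third_deg_zero]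
  right_inv a := by simp [Abelian.Ext.comp_assoc_of_third_deg_zero]

lemma EE_congr_left (e : X ≃ₗ[R] Y) {j : ℕ} (h : Subsingleton (EE R Y L j)) :
    Subsingleton (EE R X L j) :=
  (extIsoLeft e.toModuleIso (ModuleCat.of R L) j).toEquiv.subsingleton_congr.1 h

lemma EE_congr_right (e : X ≃ₗ[R] Y) {j : ℕ} (h : Subsingleton (EE R L X j)) :
    Subsingleton (EE R L Y j) :=
  (extIsoRight (ModuleCat.of R L) e.toModuleIso j).toEquiv.subsingleton_congr.1 h

lemma EE_of_subsingleton_left [Subsingleton X] {j : ℕ} : Subsingleton (EE R X L j) := by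
  have : Limits.IsZero (ModuleCat.of R X) := ModuleCat.isZero_of_subsingleton _
  rw [Ext_subsingleton_iff]; intro a
  have h : 𝟙 (ModuleCat.of R X) = 0 := this.eq_of_src _ _
  rw [← Abelian.Ext.mk₀_id_comp a, h]; simp

lemma mk₀_smul_id_comp (r : R) {X Y : ModuleCat.{0} R} {j : ℕ} (a : Abelian.Ext X Y j) :
    (Abelian.Ext.mk₀ (r • 𝟙 X)).comp a (zero_add j) = r • a := by
  rw [Abelian.Ext.mk₀_smul, Abelian.Ext.smul_comp, Abelian.Ext.mk₀_id_comp]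

lemma comp_mk₀_smul_id (r : R) {X Y : ModuleCat.{0} R} {j : ℕ} (a : Abelian.Ext X Y j) :
    a.comp (Abelian.Ext.mk₀ (r • 𝟙 Y)) (add_zero j) = r • a := by
  rw [Abelian.Ext.mk₀_smul, Abelian.Ext.comp_smul, Abelian.Ext.comp_mk₀_id]

lemma smul_eq_zero_of_ann_left {r : R} {X Y : ModuleCat.{0} R} {j : ℕ}
    (hr : ∀ x : X, r • x = 0) (a : Abelian.Ext X Y j) : r • a = 0 := by
  have : r • 𝟙 X = 0 := by ext x; exact hr x
  rw [← mk₀_smul_id_comp, this]; simp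

lemma mk₀_factor_zero {X Y Z N : ModuleCat.{0} R} {i : ℕ} (u : X ⟶ Y) (v : Y ⟶ Z) (w : X ⟶ Z)
    (h : w = u ≫ v) (γ : Abelian.Ext Z N i)
    (hv : (Abelian.Ext.mk₀ v).comp γ (zero_add i) = 0) :
    (Abelian.Ext.mk₀ w).comp γ (zero_add i) = 0 := by
  rw [h, ← Abelian.Ext.mk₀_comp_mk₀_assoc, hv, Abelian.Ext.comp_zero]

open scoped Pointwise in
lemma smul_exact (X : Type) [AddCommGroup X] [Module R X] (x : R) :
    Function.Exact (LinearMap.lsmul R X x) (x • (⊤ : Submodule R X)).mkQ := by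
  intro y
  rw [Submodule.mkQ_apply, Submodule.Quotient.mk_eq_zero,
    Submodule.mem_smul_pointwise_iff_exists]
  constructor
  · rintro ⟨b, -, rfl⟩; exact ⟨b, rfl⟩
  · rintro ⟨b, rfl⟩; exact ⟨b, trivial, rfl⟩

lemma smul_ses {X : Type} [AddCommGroup X] [Module R X] {x : R} (h : IsSMulRegular X x) :
    (sC _ _ (smul_exact X x)).ShortExact :=
  sC_exact _ _ _ h (Submodule.mkQ_surjective _)

lemma lsmul_comp (r : R) {X : Type} [AddCommGroup X] [Module R X] {Y : ModuleCat.{0} R} {j : ℕ}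
    (a : Abelian.Ext (ModuleCat.of R X) Y j) :
    (Abelian.Ext.mk₀ (ModuleCat.ofHom (LinearMap.lsmul R X r))).comp a (zero_add j) = r • a :=
  mk₀_smul_id_comp r a

lemma comp_lsmul (r : R) {X : ModuleCat.{0} R} {Y : Type} [AddCommGroup Y] [Module R Y] {j : ℕ}
    (a : Abelian.Ext X (ModuleCat.of R Y) j) :
    a.comp (Abelian.Ext.mk₀ (ModuleCat.ofHom (LinearMap.lsmul R Y r))) (add_zero j) = r • a :=
  comp_mk₀_smul_id r a

variable [IsLocalRing R] [IsNoetherianRing R]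

/-- Nakayama: if x in m is regular on X and Ext^{j+1}(X/x, L)=0 then Ext^j(X,L)=0. -/
lemma ext_zero_of_quot [Module.Finite R X] [Module.Finite R L] {x : R}
    (hx : x ∈ maximalIdeal R) (hreg : IsSMulRegular X x) {j : ℕ}
    (h : Subsingleton (EE R (QuotSMulTop x X) L (j+1))) : Subsingleton (EE R X L j) := by
  have hS := IsSMulRegular.smulShortComplex_shortExact (M := ModuleCat.of R X) hreg
  have hsurj : ∀ a : EE R X L j, ∃ b : EE R X L j, x • b = a := by
    intro a
    obtain ⟨b, hb⟩ := Abelian.Ext.contravariant_sequence_exact₁ hS (ModuleCat.of R L) a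
      (Nat.add_comm 1 j) (@Subsingleton.elim _ h _ _)
    exact ⟨b, by rw [← hb]; exact (mk₀_smul_id_comp x b).symm⟩
  have hfin : Module.Finite R (EE R X L j) := inferInstance
  have htop : (⊤ : Submodule R (EE R X L j)) = ⊥ := by
    refine Submodule.eq_bot_of_le_smul_of_le_jacobson_bot (Ideal.span {x}) ⊤ hfin.1 ?_ ?_
    · intro a _
      obtain ⟨b, rfl⟩ := hsurj a
      exact Submodule.smul_mem_smul (Ideal.mem_span_singleton_self x) trivial
    · rw [IsLocalRing.jacobson_eq_maximalIdeal _ bot_ne_top]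
      exact (Ideal.span_singleton_le_iff_mem _).2 hx
  exact (Submodule.subsingleton_iff R).1 (subsingleton_of_bot_eq_top htop.symm)

end ExtBasics
end

noncomputable section

section Vanish

open scoped Pointwise

open Opposite IsLocalRing RingTheory.Sequence

variable {R : Type} [CommRing R] [IsLocalRing R] [IsNoetherianRing R]

omit [IsLocalRing R] [IsNoetherianRing R] in
lemma regular_quot_prime {P : Ideal R} [P.IsPrime] {x : R} (hx : x ∉ P) :
    IsSMulRegular (R ⧸ P) x := by
  rw [isSMulRegular_iff_right_eq_zero_of_smul]
  intro y hy
  rw [Algebra.smul_def] at hy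
  rcases mul_eq_zero.1 hy with h | h
  · exact absurd (Ideal.Quotient.eq_zero_iff_mem.1 h) hx
  · exact h

lemma dim_quot_lt {N : Type} [AddCommGroup N] [Module R N] [Module.Finite R N] {x : R}
    (hx : x ∈ maximalIdeal R) (hreg : IsSMulRegular N x) {e : ℕ}
    (h : Module.supportDim R N ≤ e) [Nontrivial N] :
    ∃ e', e = e' + 1 ∧ Module.supportDim R (QuotSMulTop x N) ≤ e' := by
  have h1 := Module.supportDim_quotSMulTop_succ_eq_supportDim hreg hx
  have : Nontrivial (QuotSMulTop x N) := nontrivial_quotSMulTop_of_mem_maximalIdeal N hx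
  have h2 : Module.supportDim R (QuotSMulTop x N) ≠ ⊥ := Module.supportDim_ne_bot_of_nontrivial R _
  rw [← h1] at h
  generalize Module.supportDim R (QuotSMulTop x N) = D at *
  induction D with
  | bot => exact absurd rfl h2
  | coe D =>
    induction D using ENat.recTopCoe with
    | top => exact absurd h (by norm_cast)
    | coe D =>
      have h' : D + 1 ≤ e := by exact_mod_cast h
      refine ⟨e - 1, by omega, ?_⟩
      have : D ≤ e - 1 := by omega
      exact Nat.cast_le.2 this

lemma ext_vanish_generic (L : Type) [AddCommGroup L] [Module R L] [Module.Finite R L]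
    (T : ℕ → ℕ → Prop) (hT : ∀ e j, T (e+1) j → T e (j+1))
    (hk : ∀ e j, T e j → Subsingleton (EE R (R ⧸ maximalIdeal R) L j)) :
    ∀ (e : ℕ) (N : Type) [AddCommGroup N] [Module R N] [Module.Finite R N],
      Module.supportDim R N ≤ e → ∀ j, T e j → Subsingleton (EE R N L j) := by
  intro e
  induction e using Nat.strong_induction_on with
  | _ e ih =>
  intro N _ _ hfin hdim j hj
  revert hdim
  refine IsNoetherianRing.induction_on_isQuotientEquivQuotientPrime R hfin
    (motive := fun N _ _ _ => Module.supportDim R N ≤ e → Subsingleton (EE R N L j)) ?_ ?_ ?_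
  · intro N _ _ _ _ _
    exact EE_of_subsingleton_left
  · intro N _ _ _ P eP hdim
    refine EE_congr_left eP ?_
    rw [Module.supportDim_eq_of_equiv eP] at hdim
    by_cases hP : P.asIdeal = maximalIdeal R
    · rw [hP]; exact hk e j hj
    · have hlt : P.asIdeal < maximalIdeal R := lt_of_le_of_ne (le_maximalIdeal P.2.ne_top) hP
      obtain ⟨x, hx, hxP⟩ := Set.exists_of_ssubset hlt
      have hreg := regular_quot_prime hxP
      obtain ⟨e', rfl, h'⟩ := dim_quot_lt hx hreg hdim
      exact ext_zero_of_quot hx hreg (ih e' (by omega) _ h' (j+1) (hT _ _ hj))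
  · intro N₁ _ _ _ N₂ _ _ _ N₃ _ _ _ f g hf hg hex h1 h3 hdim
    exact contra_mid (sC_exact f g hex hf hg) _
      (h1 ((Module.supportDim_le_of_injective f hf).trans hdim))
      (h3 ((Module.supportDim_le_of_surjective g hg).trans hdim))

lemma ischebeck (L : Type) [AddCommGroup L] [Module R L] [Module.Finite R L] (r : ℕ)
    (hk : ∀ j < r, Subsingleton (EE R (R ⧸ maximalIdeal R) L j))
    (e : ℕ) (N : Type) [AddCommGroup N] [Module R N] [Module.Finite R N]
    (hN : Module.supportDim R N ≤ e) (j : ℕ) (hj : j + e < r) : Subsingleton (EE R N L j) :=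
  ext_vanish_generic L (fun e j => j + e < r) (fun e j h => by omega)
    (fun e j h => hk j (by omega)) e N hN j hj

lemma ext_vanish_high (L : Type) [AddCommGroup L] [Module R L] [Module.Finite R L] (n : ℕ)
    (hdim : ringKrullDim R = n)
    (hk : ∀ j > n, Subsingleton (EE R (R ⧸ maximalIdeal R) L j))
    (N : Type) [AddCommGroup N] [Module R N] [Module.Finite R N]
    (j : ℕ) (hj : j > n) : Subsingleton (EE R N L j) :=
  ext_vanish_generic L (fun e j => j > n) (fun e j h => by omega)
    (fun e j h => hk j (by omega)) n N
      ((Module.supportDim_le_ringKrullDim R N).trans hdim.le) j hj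

lemma ext_vanish_regular (L : Type) [AddCommGroup L] [Module R L] [Module.Finite R L] (n : ℕ)
    (hdim : ringKrullDim R = n)
    (hk : ∀ j > n, Subsingleton (EE R (R ⧸ maximalIdeal R) L j))
    (rs : List R) : (∀ r ∈ rs, r ∈ maximalIdeal R) →
    ∀ (N : Type) [AddCommGroup N] [Module R N] [Module.Finite R N],
    IsWeaklyRegular N rs → ∀ j : ℕ, j + rs.length > n → Subsingleton (EE R N L j) := by
  induction rs with
  | nil =>
    intro _ N _ _ _ _ j hj
    exact ext_vanish_high L n hdim hk N j (by simpa using hj)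
  | cons x rs ih =>
    intro hm N _ _ _ hreg j hj
    rw [isWeaklyRegular_cons_iff] at hreg
    refine ext_zero_of_quot (hm x (by simp)) hreg.1 (ih (fun r hr => hm r (by simp [hr])) _ hreg.2 _ ?_)
    simp at hj ⊢; omega

/-- Ext^{c}(K,L) has a regular sequence. -/
lemma ext_regular_seq (L : Type) [AddCommGroup L] [Module R L] [Module.Finite R L] (n : ℕ)
    (hdim : ringKrullDim R = n)
    (hk : ∀ j ≠ n, Subsingleton (EE R (R ⧸ maximalIdeal R) L j))
    (rs : List R) : (∀ r ∈ rs, r ∈ maximalIdeal R) →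
    ∀ (N : Type) [AddCommGroup N] [Module R N] [Module.Finite R N],
    IsWeaklyRegular N rs → Module.supportDim R N ≤ rs.length → ∀ j : ℕ, j + rs.length = n →
      IsWeaklyRegular (EE R N L j) rs := by
  induction rs with
  | nil =>
    intros; simp
  | cons x rs ih =>
    intro hm N _ _ _ hreg hd j hj
    by_cases hN : Subsingleton N
    · have := EE_of_subsingleton_left (R := R) (X := N) (L := L) (j := j)
      have h0 : ∀ (rs : List R) (W : Type) [AddCommGroup W] [Module R W] [Subsingleton W],
          IsWeaklyRegular W rs := by
        intro rs
        induction rs with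
        | nil => intros; simp
        | cons y ys ih =>
          intro W _ _ _
          rw [isWeaklyRegular_cons_iff]
          exact ⟨fun a b _ => Subsingleton.elim a b, ih _⟩
      exact h0 _ _
    have : Nontrivial N := not_subsingleton_iff_nontrivial.1 hN
    have hwr := hreg
    rw [isWeaklyRegular_cons_iff] at hreg ⊢
    have hxm := hm x (by simp)
    obtain ⟨e', he', hdq⟩ := dim_quot_lt hxm hreg.1 hd
    simp at he' hj
    subst he'
    have hS := IsSMulRegular.smulShortComplex_shortExact (M := ModuleCat.of R N) hreg.1
    have hv1 : Subsingleton (EE R (QuotSMulTop x N) L j) :=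
      ischebeck L n (fun j hj => hk j hj.ne) _ _ hdq j (by omega)
    have hv2 : Subsingleton (EE R N L (j+1)) :=
      ext_vanish_regular L n hdim (fun j hj => hk j hj.ne') (x :: rs) hm N hwr _ (by simp; omega)
    have hinj : IsSMulRegular (EE R N L j) x := by
      rw [isSMulRegular_iff_right_eq_zero_of_smul]
      intro a ha
      obtain ⟨b, rfl⟩ := Abelian.Ext.contravariant_sequence_exact₂ hS (ModuleCat.of R L) a
        ((mk₀_smul_id_comp x a).trans ha)
      rw [@Subsingleton.elim _ hv1 b 0]; exact Abelian.Ext.comp_zero _ _ _ _ _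
    refine ⟨hinj, ?_⟩
    have ihq := ih (fun r hr => hm r (by simp [hr])) _ hreg.2 hdq (j+1) (by omega)
    let δ : EE R N L j →ₗ[R] EE R (QuotSMulTop x N) L (j+1) :=
      { toFun := fun a => hS.extClass.comp a (Nat.add_comm 1 j)
        map_add' := fun a b => Abelian.Ext.comp_add _ _ _ _
        map_smul' := fun r a => by
          simp only [RingHom.id_apply]; exact Abelian.Ext.comp_smul _ _ _ _ }
    have hker : LinearMap.ker δ = x • ⊤ := by
      ext a
      rw [LinearMap.mem_ker, Submodule.mem_smul_pointwise_iff_exists]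
      constructor
      · intro ha
        obtain ⟨b, hb⟩ := Abelian.Ext.contravariant_sequence_exact₁ hS (ModuleCat.of R L) a
          (Nat.add_comm 1 j) ha
        exact ⟨b, trivial, by rw [← hb]; exact (mk₀_smul_id_comp x b).symm⟩
      · rintro ⟨b, -, rfl⟩
        rw [map_smul]
        refine smul_eq_zero_of_ann_left (fun y => ?_) _
        obtain ⟨y, rfl⟩ := Submodule.Quotient.mk_surjective _ y
        rw [← Submodule.Quotient.mk_smul, Submodule.Quotient.mk_eq_zero]
        exact Submodule.smul_mem_pointwise_smul _ _ _ trivial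
    have hsurj : Function.Surjective δ := by
      intro a
      exact Abelian.Ext.contravariant_sequence_exact₃ hS (ModuleCat.of R L) a
        (@Subsingleton.elim _ hv2 _ _) (Nat.add_comm 1 j)
    let eq : QuotSMulTop x (EE R N L j) ≃ₗ[R] EE R (QuotSMulTop x N) L (j+1) :=
      (Submodule.quotEquivOfEq _ _ hker.symm).trans (δ.quotKerEquivOfSurjective hsurj)
    exact (eq.isWeaklyRegular_congr rs).2 ihq

end Vanish
end

noncomputable section

section EZSec

open Opposite IsLocalRing RingTheory.Sequence
open scoped Pointwise

variable {R : Type} [CommRing R]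

/-- transition map R/I^s -> R/I^t -/
def rq (I : Ideal R) {t s : ℕ} (h : t ≤ s) :
    ModuleCat.of R (R ⧸ I ^ s) ⟶ ModuleCat.of R (R ⧸ I ^ t) :=
  ModuleCat.ofHom (Submodule.mapQ _ _ LinearMap.id (Ideal.pow_le_pow_right h))

lemma rq_comp (I : Ideal R) {t s u : ℕ} (h : t ≤ s) (h' : s ≤ u) :
    rq I h' ≫ rq I h = rq I (h.trans h') := by
  ext; rfl

def res (I : Ideal R) {t s : ℕ} (h : t ≤ s) {N : ModuleCat.{0} R} {i : ℕ}
    (α : Abelian.Ext (ModuleCat.of R (R ⧸ I ^ t)) N i) :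
    Abelian.Ext (ModuleCat.of R (R ⧸ I ^ s)) N i :=
  (Abelian.Ext.mk₀ (rq I h)).comp α (zero_add i)

variable (I : Ideal R)

lemma res_res {t s u : ℕ} (h : t ≤ s) (h' : s ≤ u) {N : ModuleCat.{0} R} {i : ℕ}
    (α : Abelian.Ext (ModuleCat.of R (R ⧸ I ^ t)) N i) :
    res I h' (res I h α) = res I (h.trans h') α := by
  unfold res
  rw [Abelian.Ext.mk₀_comp_mk₀_assoc, rq_comp]

lemma res_comp {t s : ℕ} (h : t ≤ s) {N N' : ModuleCat.{0} R} {i j k : ℕ}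
    (α : Abelian.Ext (ModuleCat.of R (R ⧸ I ^ t)) N i) (β : Abelian.Ext N N' j) (hk : i + j = k) :
    res I h (α.comp β hk) = (res I h α).comp β hk := by
  unfold res
  rw [Abelian.Ext.comp_assoc _ _ _ (zero_add i) hk (by omega)]

lemma res_smul {t s : ℕ} (h : t ≤ s) {N : ModuleCat.{0} R} {i : ℕ} (r : R)
    (α : Abelian.Ext (ModuleCat.of R (R ⧸ I ^ t)) N i) :
    res I h (r • α) = r • res I h α := Abelian.Ext.comp_smul _ _ _ _

lemma res_zero {t s : ℕ} (h : t ≤ s) {N : ModuleCat.{0} R} {i : ℕ} :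
    res I h (0 : Abelian.Ext (ModuleCat.of R (R ⧸ I ^ t)) N i) = 0 :=
  Abelian.Ext.comp_zero _ _ _ _ _

/-- vanishing of local cohomology, phrased elementwise -/
def EZ (i : ℕ) (N : ModuleCat.{0} R) : Prop :=
  ∀ (t : ℕ) (α : Abelian.Ext (ModuleCat.of R (R ⧸ I ^ t)) N i),
    ∃ (s : ℕ) (h : t ≤ s), res I h α = 0

variable {I}

lemma EZ_mid {S : ShortComplex (ModuleCat.{0} R)} (hS : S.ShortExact) {i : ℕ}
    (h1 : EZ I i S.X₁) (h3 : EZ I i S.X₃) : EZ I i S.X₂ := by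
  intro t α
  obtain ⟨s, hs, e⟩ := h3 t (α.comp (Abelian.Ext.mk₀ S.g) (add_zero i))
  rw [res_comp] at e
  obtain ⟨β, hβ⟩ := Abelian.Ext.covariant_sequence_exact₂ _ hS _ e
  obtain ⟨u, hu, e'⟩ := h1 s β
  refine ⟨u, hs.trans hu, ?_⟩
  rw [← res_res I hs hu, ← hβ, res_comp, e', Abelian.Ext.zero_comp]

lemma EZ_right {S : ShortComplex (ModuleCat.{0} R)} (hS : S.ShortExact) {i : ℕ}
    (h2 : EZ I i S.X₂) (h1 : EZ I (i+1) S.X₁) : EZ I i S.X₃ := by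
  intro t α
  obtain ⟨s, hs, e⟩ := h1 t (α.comp hS.extClass rfl)
  rw [res_comp] at e
  obtain ⟨β, hβ⟩ := Abelian.Ext.covariant_sequence_exact₃ _ hS _ _ e
  obtain ⟨u, hu, e'⟩ := h2 s β
  refine ⟨u, hs.trans hu, ?_⟩
  rw [← res_res I hs hu, ← hβ, res_comp, e', Abelian.Ext.zero_comp]

lemma EZ_iso {N N' : ModuleCat.{0} R} (e : N ≅ N') {i : ℕ} (h : EZ I i N) : EZ I i N' := by
  intro t α
  obtain ⟨s, hs, e1⟩ := h t (α.comp (Abelian.Ext.mk₀ e.inv) (add_zero i))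
  refine ⟨s, hs, ?_⟩
  have : α = (α.comp (Abelian.Ext.mk₀ e.inv) (add_zero i)).comp (Abelian.Ext.mk₀ e.hom) (add_zero i) := by
    simp
  rw [this, res_comp, e1, Abelian.Ext.zero_comp]

lemma EZ_zero {N : Type} [AddCommGroup N] [Module R N] [Subsingleton N] {i : ℕ} :
    EZ I i (ModuleCat.of R N) := by
  intro t α
  refine ⟨t, le_rfl, ?_⟩
  have : Limits.IsZero (ModuleCat.of R N) := ModuleCat.isZero_of_subsingleton _
  have h : 𝟙 (ModuleCat.of R N) = 0 := this.eq_of_src _ _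
  have h2 : α = 0 := by rw [← Abelian.Ext.comp_mk₀_id α, h]; simp
  rw [h2, res_zero]

variable [IsNoetherianRing R]

/-- morphism of short exact sequences given by linear maps -/
lemma ext_restrict_zero {X₁ X₂ X₃ Y₁ Y₂ Y₃ : Type} [AddCommGroup X₁] [Module R X₁]
    [AddCommGroup X₂] [Module R X₂] [AddCommGroup X₃] [Module R X₃]
    [AddCommGroup Y₁] [Module R Y₁] [AddCommGroup Y₂] [Module R Y₂] [AddCommGroup Y₃] [Module R Y₃]
    (f : X₁ →ₗ[R] X₂) (g : X₂ →ₗ[R] X₃) (h : Function.Exact f g)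
    (hf : Function.Injective f) (hg : Function.Surjective g)
    (f' : Y₁ →ₗ[R] Y₂) (g' : Y₂ →ₗ[R] Y₃) (h' : Function.Exact f' g')
    (hf' : Function.Injective f') (hg' : Function.Surjective g')
    (a : X₁ →ₗ[R] Y₁) (b : X₂ →ₗ[R] Y₂) (c : X₃ →ₗ[R] Y₃)
    (hab : f' ∘ₗ a = b ∘ₗ f) (hbc : g' ∘ₗ b = c ∘ₗ g) {N : ModuleCat.{0} R} {i j : ℕ}
    (hij : 1 + i = j)
    (γ : Abelian.Ext (ModuleCat.of R Y₁) N i)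
    (hγ : (Abelian.Ext.mk₀ (ModuleCat.ofHom a)).comp γ (zero_add i) = 0) :
    (Abelian.Ext.mk₀ (ModuleCat.ofHom c)).comp
      ((sC_exact f' g' h' hf' hg').extClass.comp γ hij) (zero_add j) = 0 := by
  let φ : sC f g h ⟶ sC f' g' h' :=
    { τ₁ := ModuleCat.ofHom a
      τ₂ := ModuleCat.ofHom b
      τ₃ := ModuleCat.ofHom c
      comm₁₂ := by ext x; exact DFunLike.congr_fun hab x
      comm₂₃ := by ext x; exact DFunLike.congr_fun hbc x }
  have nat := ShortComplex.ShortExact.extClass_naturality (sC_exact f g h hf hg)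
    (sC_exact f' g' h' hf' hg') φ
  have e1 := Abelian.Ext.comp_assoc (Abelian.Ext.mk₀ φ.τ₃) (sC_exact f' g' h' hf' hg').extClass γ
    (zero_add 1) hij (by omega)
  have e2 := Abelian.Ext.comp_assoc (sC_exact f g h hf hg).extClass (Abelian.Ext.mk₀ φ.τ₁) γ
    (add_zero 1) (zero_add i) (by omega)
  refine e1.symm.trans ?_
  rw [← nat, e2]
  have : (Abelian.Ext.mk₀ φ.τ₁).comp γ (zero_add i) = 0 := hγ
  rw [this]; exact Abelian.Ext.comp_zero _ _ _ _ _

lemma ext_restrict_step {N : ModuleCat.{0} R} {F X : Type} [AddCommGroup F] [Module R F]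
    [Module.Finite R F] [AddCommGroup X] [Module R X] (p : F →ₗ[R] X)
    (hp : Function.Surjective p) (K : Submodule R F) (hex : Function.Exact K.subtype p) (i : ℕ)
    (γ : Abelian.Ext (ModuleCat.of R K) N i) (s0 : ℕ)
    (hs0 : (Abelian.Ext.mk₀ (ModuleCat.ofHom (I ^ s0 • ⊤ : Submodule R K).subtype)).comp γ
      (zero_add i) = 0) :
    ∃ s : ℕ, (Abelian.Ext.mk₀ (ModuleCat.ofHom (I ^ s • ⊤ : Submodule R X).subtype)).comp
      ((sC_exact K.subtype p hex K.injective_subtype hp).extClass.comp γ (Nat.add_comm 1 i))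
      (zero_add (i+1)) = 0 := by
  obtain ⟨c, hc⟩ := Ideal.exists_pow_inf_eq_pow_smul I K
  refine ⟨s0 + c, ?_⟩
  set s := s0 + c with hs
  let G : Submodule R F := I ^ s • ⊤
  let G' : Submodule R X := I ^ s • ⊤
  let H : Submodule R F := G ⊓ K
  have hpG : ∀ y ∈ G, p y ∈ G' := by
    intro y hy
    refine Submodule.smul_induction_on hy ?_ ?_
    · intro r hr m _
      rw [map_smul]; exact Submodule.smul_mem_smul hr trivial
    · intro a b ha hb
      rw [map_add]; exact add_mem ha hb
  have hpG' : ∀ y ∈ G', ∃ z ∈ G, p z = y := by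
    intro y hy
    refine Submodule.smul_induction_on hy ?_ ?_
    · intro r hr m _
      obtain ⟨m, rfl⟩ := hp m
      exact ⟨r • m, Submodule.smul_mem_smul hr trivial, map_smul _ _ _⟩
    · rintro a b ⟨a, ha, rfl⟩ ⟨b, hb, rfl⟩
      exact ⟨a + b, add_mem ha hb, map_add _ _ _⟩
  have hHK : H ≤ I ^ s0 • K := by
    have := hc s (by omega)
    have h2 : s - c = s0 := by omega
    rw [h2] at this
    change I ^ s • ⊤ ⊓ K ≤ _
    rw [this]
    exact Submodule.smul_mono le_rfl inf_le_right
  let T : Submodule R K := I ^ s0 • ⊤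
  have key : ∀ y : H, (Submodule.inclusion (inf_le_right : H ≤ K)) y ∈ T := by
    intro y
    have h1 : T.map K.subtype = I ^ s0 • K := by
      rw [Submodule.map_smul'', Submodule.map_top, Submodule.range_subtype]
    have h2 := hHK y.2
    rw [← h1] at h2
    obtain ⟨z, hz, hzy⟩ := h2
    have : z = (Submodule.inclusion (inf_le_right : H ≤ K)) y := Subtype.ext hzy
    rwa [← this]
  let u : H →ₗ[R] T := (Submodule.inclusion (inf_le_right : H ≤ K)).codRestrict _ key
  have h0 : (Abelian.Ext.mk₀ (ModuleCat.ofHom (Submodule.inclusion (inf_le_right : H ≤ K)))).comp γ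
      (zero_add i) = 0 :=
    mk₀_factor_zero (ModuleCat.ofHom u) (ModuleCat.ofHom T.subtype) _ rfl γ hs0
  refine ext_restrict_zero (Submodule.inclusion (inf_le_left : H ≤ G))
    (p.restrict hpG) ?_ ?_ ?_ K.subtype p hex K.injective_subtype hp
    (Submodule.inclusion (inf_le_right : H ≤ K)) G.subtype G'.subtype rfl rfl
    (Nat.add_comm 1 i) γ h0
  · intro y
    constructor
    · intro hy
      have : p y.1 = 0 := congrArg Subtype.val hy
      obtain ⟨w, hw⟩ := (hex y.1).1 this
      exact ⟨⟨y.1, y.2, hw ▸ w.2⟩, rfl⟩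
    · rintro ⟨z, rfl⟩
      exact Subtype.ext ((hex z.1).2 ⟨⟨z.1, z.2.2⟩, rfl⟩)
  · exact Submodule.inclusion_injective _
  · rintro ⟨y, hy⟩
    obtain ⟨z, hz, rfl⟩ := hpG' y hy
    exact ⟨⟨z, hz⟩, rfl⟩

lemma ext_proj {F : Type} [AddCommGroup F] [Module R F] [Module.Free R F]
    (N : ModuleCat.{0} R) (i : ℕ) :
    Subsingleton (Abelian.Ext (ModuleCat.of R F) N (i+1)) := by
  have : Projective (ModuleCat.of R F) := (IsProjective.iff_projective (R := R) F).1 inferInstance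
  rw [Ext_subsingleton_iff]; intro a
  exact Abelian.Ext.eq_zero_of_projective a

lemma ext_restrict_pow {N : Type} [AddCommGroup N] [Module R N]
    (hN : ∀ x ∈ I, ∀ y : N, x • y = 0) (i : ℕ) :
    ∀ (X : Type) [AddCommGroup X] [Module R X] [Module.Finite R X] (β : EE R X N i),
    ∃ s : ℕ, (Abelian.Ext.mk₀ (ModuleCat.ofHom (I ^ s • ⊤ : Submodule R X).subtype)).comp β
      (zero_add i) = 0 := by
  induction i with
  | zero =>
    intro X _ _ _ β
    obtain ⟨f, rfl⟩ := Abelian.Ext.mk₀_bijective _ _ |>.2 β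
    refine ⟨1, ?_⟩
    rw [Abelian.Ext.mk₀_comp_mk₀]
    suffices h : ModuleCat.ofHom (I ^ 1 • ⊤ : Submodule R X).subtype ≫ f = 0 by
      rw [h, Abelian.Ext.mk₀_zero]
    ext ⟨y, hy⟩
    rw [pow_one] at hy
    change f.hom y = 0
    refine Submodule.smul_induction_on hy ?_ ?_
    · intro r hr m _
      rw [map_smul]; exact hN r hr _
    · intro a b ha hb
      rw [map_add, ha, hb, add_zero]
  | succ i ih =>
    intro X _ _ _ β
    obtain ⟨F, _, _, _, _, p, hp⟩ := Module.exists_finite_presentation R X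
    have hex : Function.Exact (LinearMap.ker p).subtype p := by
      rw [LinearMap.exact_iff]; simp
    have hS := sC_exact (LinearMap.ker p).subtype p hex (LinearMap.ker p).injective_subtype hp
    have hproj := ext_proj (R := R) (F := F) (ModuleCat.of R N) i
    obtain ⟨γ, rfl⟩ := Abelian.Ext.contravariant_sequence_exact₃ hS (ModuleCat.of R N) β
      (@Subsingleton.elim _ hproj _ _) (Nat.add_comm 1 i)
    obtain ⟨s0, hs0⟩ := ih (LinearMap.ker p) γ
    exact ext_restrict_step p hp _ hex i γ s0 hs0

omit [IsNoetherianRing R] in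
lemma quot_exact (J : Ideal R) : Function.Exact (Submodule.subtype J) (Submodule.mkQ J) := by
  rw [LinearMap.exact_iff]; simp

lemma ext_restrict_quot {N : ModuleCat.{0} R} {J J' : Ideal R} (hle : J' ≤ J) (i s : ℕ)
    (γ : Abelian.Ext (ModuleCat.of R J) N i) (hle2 : J' ≤ I ^ s * J)
    (hs : (Abelian.Ext.mk₀ (ModuleCat.ofHom (I ^ s • ⊤ : Submodule R J).subtype)).comp γ
      (zero_add i) = 0) :
    (Abelian.Ext.mk₀ (ModuleCat.ofHom (Submodule.mapQ J' J LinearMap.id hle))).comp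
      ((sC_exact _ _ (quot_exact J) (Submodule.injective_subtype J)
        (Submodule.mkQ_surjective J)).extClass.comp γ (Nat.add_comm 1 i)) (zero_add (i+1)) = 0 := by
  let T : Submodule R J := I ^ s • ⊤
  have key : ∀ y : J', Submodule.inclusion hle y ∈ T := by
    intro y
    have h1 : T.map (Submodule.subtype J) = I ^ s • J := by
      rw [Submodule.map_smul'', Submodule.map_top, Submodule.range_subtype]
    have h2 : y.1 ∈ I ^ s • J := hle2 y.2
    rw [← h1] at h2
    obtain ⟨z, hz, hzy⟩ := h2
    have : z = Submodule.inclusion hle y := Subtype.ext hzy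
    rwa [← this]
  let u : J' →ₗ[R] T := (Submodule.inclusion hle).codRestrict _ key
  have h0 : (Abelian.Ext.mk₀ (ModuleCat.ofHom (Submodule.inclusion hle))).comp γ
      (zero_add i) = 0 :=
    mk₀_factor_zero (ModuleCat.ofHom u) (ModuleCat.ofHom T.subtype) _ rfl γ hs
  exact ext_restrict_zero (Submodule.subtype J') (Submodule.mkQ J') (quot_exact J')
    (Submodule.injective_subtype _)
    (Submodule.mkQ_surjective _) (Submodule.subtype J) (Submodule.mkQ J) (quot_exact J)
    (Submodule.injective_subtype _)
    (Submodule.mkQ_surjective _) (Submodule.inclusion hle) LinearMap.id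
    (Submodule.mapQ _ _ LinearMap.id hle) rfl rfl (Nat.add_comm 1 i) γ h0

lemma EZ_base_aux {N : Type} [AddCommGroup N] [Module R N]
    (hN : ∀ x ∈ I, ∀ y : N, x • y = 0) (i : ℕ) (J : Ideal R) (β : EE R (R ⧸ J) N (i+1)) :
    ∃ s : ℕ, ∀ (J' : Ideal R) (hle : J' ≤ J), J' ≤ I ^ s * J →
      (Abelian.Ext.mk₀ (ModuleCat.ofHom (Submodule.mapQ J' J LinearMap.id hle))).comp β
        (zero_add (i+1)) = 0 := by
  have hproj := ext_proj (R := R) (F := R) (ModuleCat.of R N) i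
  obtain ⟨γ, hγ⟩ := Abelian.Ext.contravariant_sequence_exact₃ (sC_exact _ _ (quot_exact J)
    (Submodule.injective_subtype J) (Submodule.mkQ_surjective J)) (ModuleCat.of R N) β
    (@Subsingleton.elim _ hproj _ _) (Nat.add_comm 1 i)
  subst hγ
  obtain ⟨s, hs⟩ := ext_restrict_pow hN i J γ
  refine ⟨s, fun J' hle hle2 => ?_⟩
  exact ext_restrict_quot hle i s γ hle2 hs

lemma EZ_base {N : Type} [AddCommGroup N] [Module R N]
    (hN : ∀ x ∈ I, ∀ y : N, x • y = 0) (i : ℕ) : EZ I (i+1) (ModuleCat.of R N) := by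
  intro t β
  obtain ⟨s, hs⟩ := EZ_base_aux hN i _ β
  refine ⟨s + t, by omega, ?_⟩
  exact hs _ (Ideal.pow_le_pow_right (by omega)) (by rw [← pow_add])

variable [IsLocalRing R]

lemma EZ_vanish : ∀ (e : ℕ) (N : Type) [AddCommGroup N] [Module R N] [Module.Finite R N],
    Module.supportDim R N ≤ e → ∀ i, e < i → EZ (maximalIdeal R) i (ModuleCat.of R N) := by
  intro e
  induction e using Nat.strong_induction_on with
  | _ e ih =>
  intro N _ _ hfin hdim i hi
  revert hdim
  refine IsNoetherianRing.induction_on_isQuotientEquivQuotientPrime R hfin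
    (motive := fun N _ _ _ => Module.supportDim R N ≤ e →
      EZ (maximalIdeal R) i (ModuleCat.of R N)) ?_ ?_ ?_
  · intro N _ _ _ _ _
    exact EZ_zero
  · intro N _ _ _ P eP hdim
    refine EZ_iso eP.symm.toModuleIso ?_
    rw [Module.supportDim_eq_of_equiv eP] at hdim
    by_cases hP : P.asIdeal = maximalIdeal R
    · obtain ⟨i, rfl⟩ : ∃ i', i = i' + 1 := ⟨i - 1, by omega⟩
      refine EZ_base (fun x hx y => ?_) i
      obtain ⟨y, rfl⟩ := Submodule.Quotient.mk_surjective _ y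
      rw [← Submodule.Quotient.mk_smul, Submodule.Quotient.mk_eq_zero, smul_eq_mul]
      exact Ideal.mul_mem_right _ _ (hP ▸ hx)
    · have hlt : P.asIdeal < maximalIdeal R := lt_of_le_of_ne (le_maximalIdeal P.2.ne_top) hP
      obtain ⟨x, hx, hxP⟩ := Set.exists_of_ssubset hlt
      have hreg := regular_quot_prime hxP
      obtain ⟨e', rfl, h'⟩ := dim_quot_lt hx hreg hdim
      have hS := smul_ses hreg
      obtain ⟨i, rfl⟩ : ∃ i', i = i' + 1 := ⟨i - 1, by omega⟩
      have hq := ih e' (by omega) _ h' i (by omega)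
      have claim : ∀ a t (α : Abelian.Ext (ModuleCat.of R (R ⧸ maximalIdeal R ^ t))
          (ModuleCat.of R (R ⧸ P.asIdeal)) (i+1)), x ^ a • α = 0 →
          ∃ (s : ℕ) (h : t ≤ s), res _ h α = 0 := by
        intro a
        induction a with
        | zero => intro t α h; exact ⟨t, le_rfl, by rw [pow_zero, one_smul] at h; rw [h, res_zero]⟩
        | succ a iha =>
          intro t α h
          rw [pow_succ', mul_smul] at h
          obtain ⟨γ, hγ⟩ := Abelian.Ext.covariant_sequence_exact₁ _ hS (x ^ a • α)
            ((comp_lsmul x _).trans h) rfl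
          obtain ⟨s, hs, e1⟩ := hq t γ
          obtain ⟨u, hu, e2⟩ := iha s (res _ hs α) (by
            rw [← res_smul, ← hγ, res_comp, e1, Abelian.Ext.zero_comp])
          exact ⟨u, hs.trans hu, by rw [← res_res _ hs hu, e2]⟩
      intro t α
      refine claim t t α (smul_eq_zero_of_ann_left (fun y => ?_) _)
      obtain ⟨y, rfl⟩ := Submodule.Quotient.mk_surjective _ y
      rw [← Submodule.Quotient.mk_smul, Submodule.Quotient.mk_eq_zero, smul_eq_mul]
      exact Ideal.mul_mem_right _ _ (Ideal.pow_mem_pow hx t)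
  · intro N₁ _ _ _ N₂ _ _ _ N₃ _ _ _ f g hf hg hex h1 h3 hdim
    exact EZ_mid (sC_exact f g hex hf hg)
      (h1 ((Module.supportDim_le_of_injective f hf).trans hdim))
      (h3 ((Module.supportDim_le_of_surjective g hg).trans hdim))

end EZSec
end

noncomputable section

section NonVan

open Opposite IsLocalRing RingTheory.Sequence
open scoped Pointwise

variable {R : Type} [CommRing R] [IsNoetherianRing R] [IsLocalRing R]

omit [IsNoetherianRing R] in
lemma dim_quot_pow (t : ℕ) : Module.supportDim R (R ⧸ maximalIdeal R ^ t) ≤ (0 : ℕ) := by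
  have : Subsingleton (Module.support R (R ⧸ maximalIdeal R ^ t)) := by
    constructor
    have key : ∀ p ∈ Module.support R (R ⧸ maximalIdeal R ^ t), p.asIdeal = maximalIdeal R := by
      intro p hp
      rw [Module.support_eq_zeroLocus, Ideal.annihilator_quotient, PrimeSpectrum.mem_zeroLocus] at hp
      refine le_antisymm (le_maximalIdeal p.2.ne_top) ?_
      exact p.2.le_of_pow_le hp
    intro p q
    exact Subtype.ext (PrimeSpectrum.ext ((key _ p.2).trans (key _ q.2).symm))
  exact Order.krullDim_nonpos_of_subsingleton

lemma ext_pow_zero {S : Type} [AddCommGroup S] [Module R S] [Module.Finite R S] {e : ℕ}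
    (h : ∀ j < e, Subsingleton (EE R (R ⧸ maximalIdeal R) S j)) (t j : ℕ) (hj : j < e) :
    Subsingleton (EE R (R ⧸ maximalIdeal R ^ t) S j) :=
  ischebeck S e h 0 _ (dim_quot_pow t) j (by omega)

omit [IsNoetherianRing R] in
lemma exists_regular_of_hom_zero [IsNoetherianRing R] {S : Type} [AddCommGroup S] [Module R S]
    [Module.Finite R S] (h : Subsingleton (EE R (R ⧸ maximalIdeal R) S 0)) :
    ∃ x ∈ maximalIdeal R, IsSMulRegular S x := by
  have h1 : Subsingleton (ModuleCat.of R (R ⧸ maximalIdeal R) ⟶ ModuleCat.of R S) :=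
    Abelian.Ext.addEquiv₀.subsingleton_congr.mp h
  have h2 : Subsingleton ((R ⧸ maximalIdeal R) →ₗ[R] S) :=
    (ModuleCat.homAddEquiv (M := ModuleCat.of R (R ⧸ maximalIdeal R)) (N := ModuleCat.of R S)).symm.subsingleton
  obtain ⟨x, hx, hr⟩ := IsSMulRegular.subsingleton_linearMap_iff.1 h2
  rw [Ideal.annihilator_quotient] at hx
  exact ⟨x, hx, hr⟩

lemma annih_zero_aux {S : Type} [AddCommGroup S] [Module R S] (J : Ideal R) (a : R)
    (y : S) (hy : ∀ r ∈ J, r • y = 0) :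
    ∃ α : EE R (R ⧸ J) S 0, ∀ (J' : Ideal R) (h : J' ≤ J),
      a • (Abelian.Ext.mk₀ (ModuleCat.ofHom (Submodule.mapQ J' J LinearMap.id h))).comp α
        (zero_add 0) = 0 → a • y = 0 := by
  let f : (R ⧸ J) →ₗ[R] S := Submodule.liftQ J (LinearMap.toSpanSingleton R S y) (by
    intro r hr; simpa using hy r hr)
  refine ⟨Abelian.Ext.mk₀ (ModuleCat.ofHom f), fun J' h this => ?_⟩
  rw [Abelian.Ext.mk₀_comp_mk₀, ← Abelian.Ext.mk₀_smul, ← Abelian.Ext.mk₀_zero] at this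
  have := (Abelian.Ext.mk₀_bijective _ _).1 this
  have := ConcreteCategory.congr_hom this (Submodule.Quotient.mk (1:R))
  have h2 : a • ((1:R) • y) = 0 := this
  rwa [one_smul] at h2

lemma annih_zero (a : R) (S : Type) [AddCommGroup S] [Module R S] [Module.Finite R S]
    [Nontrivial S] (hdim : Module.supportDim R S ≤ (0:ℕ))
    (hA : ∀ t (α : EE R (R ⧸ maximalIdeal R ^ t) S 0), ∃ (s : ℕ) (h : t ≤ s),
      a • res (maximalIdeal R) h α = 0) (y : S) : a • y = 0 := by
  have hd0 : Module.supportDim R S = 0 := by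
    refine le_antisymm hdim ?_
    have := Module.supportDim_ne_bot_of_nontrivial R S
    generalize Module.supportDim R S = D at *
    induction D with
    | bot => exact absurd rfl this
    | coe D => exact WithBot.coe_le_coe.2 bot_le
  have h1 := support_of_supportDim_eq_zero R S hd0
  rw [Module.support_eq_zeroLocus] at h1
  have h2 : maximalIdeal R ≤ (Module.annihilator R S).radical := by
    rw [← PrimeSpectrum.zeroLocus_subset_zeroLocus_iff, h1]
  obtain ⟨c, hc⟩ := Ideal.exists_pow_le_of_le_radical_of_fg h2 (IsNoetherian.noetherian _)
  obtain ⟨α, hα⟩ := annih_zero_aux (maximalIdeal R ^ c) a y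
    (fun r hr => Module.mem_annihilator.1 (hc hr) y)
  obtain ⟨s, hs, e⟩ := hA c α
  exact hα _ (Ideal.pow_le_pow_right hs) e

lemma annih_claim (a : R) : ∀ (e : ℕ) (S : Type) [AddCommGroup S] [Module R S] [Module.Finite R S]
    [Nontrivial S],
    Module.supportDim R S ≤ e → (∀ j < e, Subsingleton (EE R (R ⧸ maximalIdeal R) S j)) →
    (∀ t (α : EE R (R ⧸ maximalIdeal R ^ t) S e), ∃ (s : ℕ) (h : t ≤ s),
      a • res (maximalIdeal R) h α = 0) →
    ∀ (p : ℕ) (y : S), a • y ∈ (maximalIdeal R ^ p • ⊤ : Submodule R S) := by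
  intro e
  induction e with
  | zero =>
    intro S _ _ _ _ hdim _ hA p y
    rw [annih_zero a S hdim hA y]; exact zero_mem _
  | succ e ih =>
    intro S _ _ _ _ hdim hdep hA p y
    obtain ⟨x, hx, hreg⟩ := exists_regular_of_hom_zero (hdep 0 (by omega))
    have hregp := hreg.pow (p+1)
    have hxp : x ^ (p+1) ∈ maximalIdeal R := Ideal.pow_mem_of_mem _ hx _ (by omega)
    obtain ⟨e', he', hdq⟩ := dim_quot_lt hxp hregp hdim
    obtain rfl : e' = e := by omega
    have hnt : Nontrivial (QuotSMulTop (x^(p+1)) S) := nontrivial_quotSMulTop_of_mem_maximalIdeal S hxp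
    have hS := smul_ses hregp
    have h1 := ih (QuotSMulTop (x^(p+1)) S) hdq
      (fun j hj => co_right hS _ (hdep j (by omega)) (hdep (j+1) (by omega))) ?_ p (Submodule.Quotient.mk y)
    · have h2 : (maximalIdeal R ^ p • ⊤ : Submodule R (QuotSMulTop (x^(p+1)) S)) =
        (maximalIdeal R ^ p • ⊤ : Submodule R S).map (Submodule.mkQ _) := by
        rw [Submodule.map_smul'', Submodule.map_top, Submodule.range_mkQ]
      rw [h2] at h1
      obtain ⟨z, hz, hzy⟩ := h1
      rw [← Submodule.Quotient.mk_smul, Submodule.mkQ_apply, Submodule.Quotient.eq,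
        Submodule.mem_smul_pointwise_iff_exists] at hzy
      obtain ⟨w, -, hw⟩ := hzy
      have : a • y = z - x^(p+1) • w := by rw [hw]; abel
      rw [this]
      refine sub_mem hz (Submodule.smul_mem_smul ?_ trivial)
      exact Ideal.pow_le_pow_right (Nat.le_succ p) (Ideal.pow_mem_pow hx _)
    · intro t α
      obtain ⟨s, hs, e1⟩ := hA t (α.comp hS.extClass rfl)
      refine ⟨s, hs, ?_⟩
      rw [res_comp, ← Abelian.Ext.smul_comp] at e1
      obtain ⟨β, hβ⟩ := Abelian.Ext.covariant_sequence_exact₃ _ hS _ _ e1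
      have := ext_pow_zero hdep s e' (by omega)
      rw [← hβ, @Subsingleton.elim _ this β 0]
      exact Abelian.Ext.zero_comp _ _ _ _ _

end NonVan
end

noncomputable section

section NonVan2

open Opposite IsLocalRing RingTheory.Sequence
open scoped Pointwise

variable {R : Type} [CommRing R] [IsNoetherianRing R] [IsLocalRing R]

omit [IsNoetherianRing R] [IsLocalRing R] in
lemma quot_ext_vanish (W : Type) [AddCommGroup W] [Module R W] (rs : List R) :
    ∀ (r : ℕ) (S : Type) [AddCommGroup S] [Module R S], IsWeaklyRegular S rs →
    (∀ j < r, Subsingleton (EE R W S j)) → ∀ j, j + rs.length < r →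
    Subsingleton (EE R W (S ⧸ Ideal.ofList rs • (⊤ : Submodule R S)) j) := by
  induction rs with
  | nil =>
    intro r S _ _ _ h j hj
    refine EE_congr_right (X := S) ?_ (h j (by simpa using hj))
    exact (Submodule.quotEquivOfEqBot _ (by simp)).symm
  | cons x rs ih =>
    intro r S _ _ hreg h j hj
    rw [isWeaklyRegular_cons_iff] at hreg
    refine EE_congr_right (Submodule.quotOfListConsSMulTopEquivQuotSMulTopInner S x rs).symm ?_
    simp only [List.length_cons] at hj
    refine ih (r-1) _ hreg.2 (fun j hj => ?_) j (by omega)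
    exact co_right (smul_ses hreg.1) _ (h j (by omega)) (h (j+1) (by omega))

omit [IsNoetherianRing R] [IsLocalRing R] in
lemma dim_eq_coe {N : Type} [AddCommGroup N] [Module R N] {n : ℕ} [Nontrivial N]
    (h : Module.supportDim R N ≤ n) : ∃ e : ℕ, Module.supportDim R N = e ∧ e ≤ n := by
  have := Module.supportDim_ne_bot_of_nontrivial R N
  generalize Module.supportDim R N = D at *
  induction D with
  | bot => exact absurd rfl this
  | coe D =>
    have h : D ≤ (n:ℕ∞) := by exact_mod_cast h
    obtain ⟨e, rfl⟩ := ENat.ne_top_iff_exists.1 (ne_top_of_le_ne_top (ENat.natCast_ne_top n) h)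
    exact ⟨e, rfl, by exact_mod_cast h⟩

lemma hom_ne_zero_aux {N S : Type} [AddCommGroup N] [Module R N] [Module.Finite R N] [Nontrivial N]
    [AddCommGroup S] [Module R S] [Module.Finite R S] {e : ℕ} (hN : Module.supportDim R N = e)
    (hS : Module.supportDim R S ≤ e) (hann : Module.annihilator R S ≤ Module.annihilator R N) :
    ∃ f : N →ₗ[R] S, f ≠ 0 := by
  by_contra! hc
  have : Subsingleton (N →ₗ[R] S) := ⟨fun a b => by rw [hc a, hc b]⟩
  obtain ⟨r, hr, hreg⟩ := IsSMulRegular.subsingleton_linearMap_iff.1 this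
  have hrm : r ∈ maximalIdeal R := by
    refine le_maximalIdeal ?_ hr
    intro h
    rw [Module.annihilator_eq_top_iff] at h
    exact not_subsingleton N h
  have hsub : Module.support R N ⊆ Module.support R (QuotSMulTop r S) := by
    rw [Module.support_quotSMulTop, Module.support_eq_zeroLocus, Module.support_eq_zeroLocus]
    refine Set.subset_inter (PrimeSpectrum.zeroLocus_anti_mono hann) ?_
    exact PrimeSpectrum.zeroLocus_anti_mono (by simpa using hr)
  have hNS : Nontrivial S := by
    by_contra h
    rw [not_nontrivial_iff_subsingleton] at h
    have : Module.annihilator R N = ⊤ := top_le_iff.1 ((Module.annihilator_eq_top_iff.2 h).symm.le.trans hann)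
    rw [Module.annihilator_eq_top_iff] at this
    exact not_subsingleton N this
  obtain ⟨e', he, h2⟩ := dim_quot_lt hrm hreg hS
  have h3 : Module.supportDim R N ≤ Module.supportDim R (QuotSMulTop r S) :=
    Order.krullDim_le_of_strictMono (Set.inclusion hsub) (fun _ _ h => h)
  rw [hN] at h3
  have := h3.trans h2
  have : e ≤ e' := by exact_mod_cast this
  omega

/-- key construction: the CM quotient -/
lemma exists_cm_quot {n : ℕ} (hdim : ringKrullDim R = n)
    (hk : ∀ j ≠ n, Subsingleton (EE R (R ⧸ maximalIdeal R) R j))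
    (N : Type) [AddCommGroup N] [Module R N] [Module.Finite R N] [Nontrivial N] {e : ℕ}
    (hN : Module.supportDim R N = e) :
    ∃ J : Ideal R, J ≤ Module.annihilator R N ∧ Module.supportDim R (R ⧸ J) ≤ e ∧
      ∀ j < e, Subsingleton (EE R (R ⧸ maximalIdeal R) (R ⧸ J) j) := by
  have hen : e ≤ n := by
    have := Module.supportDim_le_ringKrullDim R N
    rw [hN, hdim] at this
    exact_mod_cast this
  have hann : Module.annihilator R N ≠ ⊤ := by
    intro h
    rw [Module.annihilator_eq_top_iff] at h
    exact not_subsingleton N h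
  obtain ⟨rs, hlen, hmem, hreg⟩ := ModuleCat.exists_isRegular_of_exists_subsingleton_ext
    (Module.annihilator R N) (n - e) (ModuleCat.of R R) (by
      rw [Ideal.smul_eq_mul, Ideal.mul_top]; exact lt_top_iff_ne_top.2 hann)
    (ModuleCat.of R N) (Module.support_eq_zeroLocus)
    (fun i hi => ischebeck R n (fun j hj => hk j (by omega)) e N hN.le i (by omega))
  have hJ : Ideal.ofList rs • (⊤ : Submodule R R) = Ideal.ofList rs := by
    rw [Ideal.smul_eq_mul, Ideal.mul_top]
  have hd := Module.supportDim_add_length_eq_supportDim_of_isRegular rs hreg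
  have hv := quot_ext_vanish (R ⧸ maximalIdeal R) rs n R hreg.toIsWeaklyRegular
    (fun j hj => hk j (by omega))
  refine ⟨Ideal.ofList rs • (⊤ : Submodule R R), ?_, ?_, ?_⟩
  · rw [hJ]; exact Ideal.span_le.2 hmem
  · rw [hlen, Module.supportDim_self_eq_ringKrullDim, hdim] at hd
    change Module.supportDim R (R ⧸ Ideal.ofList rs • (⊤ : Submodule R R)) + _ = _ at hd
    generalize Module.supportDim R (R ⧸ Ideal.ofList rs • (⊤ : Submodule R R)) = D at hd ⊢
    induction D with
    | bot => exact bot_le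
    | coe D =>
      have h : (D : WithBot ℕ∞) + (((n-e : ℕ):ℕ∞):WithBot ℕ∞) = ((n:ℕ∞):WithBot ℕ∞) := hd
      rw [← WithBot.coe_add, WithBot.coe_inj] at h
      induction D with
      | top => simp at h
      | coe D =>
        have h : D + (n-e) = n := by exact_mod_cast h
        have : D ≤ e := by omega
        exact_mod_cast this
  · intro j hj; exact hv j (by omega)

lemma EZ_nonvanish {n : ℕ} (hdim : ringKrullDim R = n)
    (hk : ∀ j ≠ n, Subsingleton (EE R (R ⧸ maximalIdeal R) R j))
    (N : Type) [AddCommGroup N] [Module R N] [Module.Finite R N] [Nontrivial N] {e : ℕ}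
    (hN : Module.supportDim R N = e) : ¬ EZ (maximalIdeal R) e (ModuleCat.of R N) := by
  intro hEZ
  obtain ⟨J, hJ, hJd, hJk⟩ := exists_cm_quot hdim hk N hN
  obtain ⟨f, hf⟩ := hom_ne_zero_aux (S := R ⧸ J) hN hJd (by rwa [Ideal.annihilator_quotient])
  have hEZr : EZ (maximalIdeal R) e (ModuleCat.of R (LinearMap.range f)) := by
    have hex : Function.Exact (LinearMap.ker f).subtype f.rangeRestrict := by
      rw [LinearMap.exact_iff]; simp
    refine EZ_right (sC_exact (LinearMap.ker f).subtype f.rangeRestrict hex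
      (Submodule.injective_subtype _) f.surjective_rangeRestrict) hEZ ?_
    exact EZ_vanish e _ ((Module.supportDim_le_of_injective (LinearMap.ker f).subtype
      (Submodule.injective_subtype _)).trans hN.le) _ (by omega)
  obtain ⟨x, hx⟩ : ∃ x, f x ≠ 0 := by
    by_contra! h; exact hf (LinearMap.ext h)
  obtain ⟨a, ha⟩ := Submodule.Quotient.mk_surjective J (f x)
  have : Nontrivial (R ⧸ J) := ⟨⟨f x, 0, hx⟩⟩
  have key := annih_claim a e (R ⧸ J) hJd hJk ?_
  · have h1 : ∀ p, a • (Submodule.Quotient.mk (1:R) : R ⧸ J) ∈ (maximalIdeal R ^ p • ⊤ : Submodule R (R ⧸ J)) :=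
      fun p => key p _
    have h2 := (Submodule.mem_iInf _).2 h1
    rw [Ideal.iInf_pow_smul_eq_bot_of_isLocalRing _ (maximalIdeal.isMaximal R).ne_top] at h2
    rw [Submodule.mem_bot, ← Submodule.Quotient.mk_smul, smul_eq_mul, mul_one, ha] at h2
    exact hx h2
  · intro t α
    have hmem : ∀ y : R ⧸ J, a • y ∈ LinearMap.range f := by
      intro y
      obtain ⟨y, rfl⟩ := Submodule.Quotient.mk_surjective J y
      rw [← Submodule.Quotient.mk_smul, smul_eq_mul, mul_comm, ← smul_eq_mul,
        Submodule.Quotient.mk_smul, ha]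
      exact Submodule.smul_mem _ _ ⟨x, rfl⟩
    let u : (R ⧸ J) →ₗ[R] LinearMap.range f := (LinearMap.lsmul R (R ⧸ J) a).codRestrict _ hmem
    have hu : ModuleCat.ofHom (LinearMap.lsmul R (R ⧸ J) a) =
      ModuleCat.ofHom u ≫ ModuleCat.ofHom (LinearMap.range f).subtype := rfl
    obtain ⟨s, hs, h0⟩ := hEZr t (α.comp (Abelian.Ext.mk₀ (ModuleCat.ofHom u)) (add_zero e))
    refine ⟨s, hs, ?_⟩
    rw [res_comp] at h0
    rw [← comp_lsmul, hu, ← Abelian.Ext.mk₀_comp_mk₀, ← Abelian.Ext.comp_assoc_of_third_deg_zero,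
      h0, Abelian.Ext.zero_comp]

end NonVan2
end

noncomputable section

section LC

open Opposite Limits

variable {R : Type} [CommRing R] (I : Ideal R)

/-- the directed system computing local cohomology -/
abbrev lcF (i : ℕ) (N : ModuleCat.{0} R) : ℕᵒᵖᵒᵖ ⥤ ModuleCat.{0} R :=
  localCohomology.diagram (localCohomology.idealPowersDiagram I) i ⋙ (evaluation _ _).obj N

def lcIso (i : ℕ) (N : ModuleCat.{0} R) :
    (localCohomology I i).obj N ≅ colimit (lcF I i N) :=
  colimitObjIsoColimitCompEvaluation
    (localCohomology.diagram (localCohomology.idealPowersDiagram I) i) N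

lemma exists_lc_bridge (i : ℕ) (N : ModuleCat.{0} R) :
    ∃ e : ∀ t : ℕ, (lcF I i N).obj (op (op t)) ≃ₗ[R]
        Abelian.Ext (ModuleCat.of R (R ⧸ I ^ t)) N i,
      ∀ (a b : ℕᵒᵖᵒᵖ) (w : a ⟶ b) (h : a.unop.unop ≤ b.unop.unop) (x : (lcF I i N).obj a),
        e b.unop.unop ((lcF I i N).map w x) = res I h (e a.unop.unop x) := by
  obtain ⟨e, he⟩ := exists_bridge (R := R) N i
  refine ⟨fun t => e _, fun a b w h x => ?_⟩
  exact he _ _ (rq I h) x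

lemma lc_iso_of (i j : ℕ) (N M : ModuleCat.{0} R)
    (φ : ∀ t : ℕ, Abelian.Ext (ModuleCat.of R (R ⧸ I ^ t)) N i ≃ₗ[R]
      Abelian.Ext (ModuleCat.of R (R ⧸ I ^ t)) M j)
    (hφ : ∀ (t s : ℕ) (h : t ≤ s) (x : Abelian.Ext (ModuleCat.of R (R ⧸ I ^ t)) N i),
      φ s (res I h x) = res I h (φ t x)) :
    Nonempty ((localCohomology I i).obj N ≅ (localCohomology I j).obj M) := by
  obtain ⟨e, he⟩ := exists_lc_bridge I i N
  obtain ⟨e', he'⟩ := exists_lc_bridge I j M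
  have α : lcF I i N ≅ lcF I j M := NatIso.ofComponents
    (fun t => ((e t.unop.unop).trans ((φ t.unop.unop).trans (e' t.unop.unop).symm)).toModuleIso)
    (by
      intro a b w
      have h : a.unop.unop ≤ b.unop.unop := w.unop.unop.down.down
      ext x
      change (e' b.unop.unop).symm (φ _ (e b.unop.unop ((lcF I i N).map w x))) =
        (lcF I j M).map w ((e' a.unop.unop).symm (φ _ (e a.unop.unop x)))
      rw [LinearEquiv.symm_apply_eq, he a b w h, he' a b w h, LinearEquiv.apply_symm_apply, hφ])
  exact ⟨lcIso I i N ≪≫ HasColimit.isoOfNatIso α ≪≫ (lcIso I j M).symm⟩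

lemma lc_subsingleton_iff (i : ℕ) (N : ModuleCat.{0} R) :
    Subsingleton ((localCohomology I i).obj N) ↔ EZ I i N := by
  obtain ⟨e, he⟩ := exists_lc_bridge I i N
  rw [(lcIso I i N).toLinearEquiv.toEquiv.subsingleton_congr]
  constructor
  · intro hs t α
    have := hs.elim (colimit.ι (lcF I i N) (op (op t)) ((e t).symm α))
      (colimit.ι (lcF I i N) (op (op t)) 0)
    obtain ⟨k, f, g, h⟩ := Concrete.colimit_exists_of_rep_eq (lcF I i N) _ _ this
    have hk : t ≤ k.unop.unop := f.unop.unop.down.down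
    refine ⟨k.unop.unop, hk, ?_⟩
    have h1 := congrArg (e k.unop.unop) h
    rw [he _ _ f hk, he _ _ g hk] at h1
    simp only [map_zero, LinearEquiv.apply_symm_apply, res_zero] at h1
    exact h1
  · intro h
    have key : ∀ x : ↥(colimit (lcF I i N)), x = 0 := by
      intro x
      obtain ⟨t, y, rfl⟩ := Concrete.colimit_exists_rep (lcF I i N) x
      obtain ⟨s, hs, h0⟩ := h t.unop.unop (e t.unop.unop y)
      let w : t ⟶ op (op s) := (homOfLE hs).op.op
      have h1 : (lcF I i N).map w y = 0 := by
        apply (e s).injective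
        refine (he t (op (op s)) w hs y).trans ?_
        rw [map_zero]; exact h0
      have h2 := ConcreteCategory.congr_hom (colimit.w (lcF I i N) w) y
      rw [← h2]
      change colimit.ι (lcF I i N) _ ((lcF I i N).map w y) = 0
      rw [h1, map_zero]
    exact ⟨fun a b => by rw [key a, key b]⟩

end LC
end

noncomputable section

section Conn

open Opposite Limits IsLocalRing

variable {R : Type} [CommRing R]

/-- connecting isomorphism -/
def connEquiv {S : ShortComplex (ModuleCat.{0} R)} (hS : S.ShortExact) (W : ModuleCat.{0} R) (i : ℕ)
    (h1 : Subsingleton (Abelian.Ext W S.X₂ i)) (h2 : Subsingleton (Abelian.Ext W S.X₂ (i+1))) :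
    Abelian.Ext W S.X₃ i ≃ₗ[R] Abelian.Ext W S.X₁ (i+1) :=
  LinearEquiv.ofBijective
    { toFun := fun a => a.comp hS.extClass rfl
      map_add' := fun a b => by simp
      map_smul' := fun r a => by simp [Abelian.Ext.smul_comp] }
    (by
      constructor
      · rw [← LinearMap.ker_eq_bot, LinearMap.ker_eq_bot']
        intro a ha
        obtain ⟨b, hb⟩ := Abelian.Ext.covariant_sequence_exact₃ W hS a rfl ha
        rw [← hb, Subsingleton.elim b 0]; exact Abelian.Ext.zero_comp _ _ _ _ _
      · intro a
        obtain ⟨b, hb⟩ := Abelian.Ext.covariant_sequence_exact₁ W hS a (Subsingleton.elim _ _) rfl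
        exact ⟨b, hb⟩)

lemma lc_iso_conn [IsNoetherianRing R] [IsLocalRing R] {S : ShortComplex (ModuleCat.{0} R)}
    (hS : S.ShortExact) [Module.Finite R S.X₂] (d : ℕ)
    (h : ∀ j < d, Subsingleton (Abelian.Ext (ModuleCat.of R (R ⧸ maximalIdeal R)) S.X₂ j))
    (i : ℕ) (hi : i + 1 < d) :
    Nonempty ((localCohomology (maximalIdeal R) i).obj S.X₃ ≅
      (localCohomology (maximalIdeal R) (i+1)).obj S.X₁) := by
  have hv : ∀ t j, j < d → Subsingleton (Abelian.Ext (ModuleCat.of R (R ⧸ maximalIdeal R ^ t)) S.X₂ j) :=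
    fun t j hj => ext_pow_zero (S := S.X₂) h t j hj
  refine lc_iso_of (maximalIdeal R) i (i+1) S.X₃ S.X₁
    (fun t => connEquiv hS _ i (hv t i (by omega)) (hv t (i+1) hi)) ?_
  intro t s hts x
  exact (res_comp _ hts x hS.extClass rfl).symm

end Conn
end

noncomputable section

section Depth

open Opposite IsLocalRing RingTheory.Sequence
open scoped Pointwise

variable {R : Type} [CommRing R] [IsLocalRing R]

lemma smul_top_lt {N : Type} [AddCommGroup N] [Module R N] [Module.Finite R N] [Nontrivial N]
    {I : Ideal R} (hI : I ≠ ⊤) : I • (⊤ : Submodule R N) < ⊤ := by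
  refine lt_top_iff_ne_top.2 fun h => ?_
  have := Submodule.eq_bot_of_le_smul_of_le_jacobson_bot I (⊤ : Submodule R N) (Module.Finite.fg_top)
    h.ge (by rw [IsLocalRing.jacobson_eq_maximalIdeal _ bot_ne_top]; exact le_maximalIdeal hI)
  exact top_ne_bot this

lemma exists_regular_of_ext [IsNoetherianRing R] {N : Type} [AddCommGroup N] [Module R N]
    [Module.Finite R N] [Nontrivial N] (I : Ideal R) (hI : I ≠ ⊤) (r : ℕ)
    (h : ∀ j < r, Subsingleton (EE R (R ⧸ I) N j)) :
    ∃ rs : List R, rs.length = r ∧ (∀ x ∈ rs, x ∈ I) ∧ IsRegular N rs :=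
  ModuleCat.exists_isRegular_of_exists_subsingleton_ext I r (ModuleCat.of R N) (smul_top_lt hI)
    (ModuleCat.of R (R ⧸ I)) (by
      change Module.support R (R ⧸ I) = _
      rw [Module.support_eq_zeroLocus, Ideal.annihilator_quotient]) h

lemma ext_of_regular [IsNoetherianRing R] {N : Type} [AddCommGroup N] [Module R N]
    [Module.Finite R N] [Nontrivial N] (rs : List R) (hm : ∀ x ∈ rs, x ∈ maximalIdeal R)
    (hreg : IsRegular N rs) : ∀ j < rs.length, Subsingleton (EE R (R ⧸ maximalIdeal R) N j) :=
  ModuleCat.subsingleton_ext_of_exists_isRegular (maximalIdeal R)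
    (ModuleCat.of R (R ⧸ maximalIdeal R)) (by
      change Module.support R (R ⧸ maximalIdeal R) ⊆ _
      rw [Module.support_eq_zeroLocus, Ideal.annihilator_quotient]) (ModuleCat.of R N)
      (smul_top_lt (maximalIdeal.isMaximal R).ne_top) rs hm hreg

lemma depth_eq [IsNoetherianRing R] {N : Type} [AddCommGroup N] [Module R N]
    [Module.Finite R N] [Nontrivial N] (r : ℕ)
    (h : ∀ j < r, Subsingleton (EE R (R ⧸ maximalIdeal R) N j))
    (h' : ¬ Subsingleton (EE R (R ⧸ maximalIdeal R) N r)) : moduleDepth R N = r := by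
  refine le_antisymm (sSup_le ?_) (le_sSup ?_)
  · rintro _ ⟨rs, rfl, hm, hreg⟩
    by_contra hc
    have : r < rs.length := by exact_mod_cast not_le.1 hc
    exact h' (ext_of_regular rs hm hreg r this)
  · obtain ⟨rs, hl, hm, hreg⟩ := exists_regular_of_ext _ (maximalIdeal.isMaximal R).ne_top r h
    exact ⟨rs, by rw [hl], hm, hreg⟩

lemma exists_regular_of_depth {N : Type} [AddCommGroup N] [Module R N]
    [Nontrivial N] (r : ℕ) (h : moduleDepth R N = r) :
    ∃ rs : List R, rs.length = r ∧ (∀ x ∈ rs, x ∈ maximalIdeal R) ∧ IsRegular N rs := by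
  have hne : Nonempty {n : ℕ∞ | ∃ rs : List R, (rs.length : ℕ∞) = n ∧
    (∀ r ∈ rs, r ∈ IsLocalRing.maximalIdeal R) ∧ RingTheory.Sequence.IsRegular N rs} :=
    ⟨⟨0, [], by simp, by simp, IsRegular.nil R N⟩⟩
  have := ENat.sSup_mem_of_nonempty_of_lt_top (s := {n : ℕ∞ | ∃ rs : List R, (rs.length : ℕ∞) = n ∧
    (∀ r ∈ rs, r ∈ IsLocalRing.maximalIdeal R) ∧ RingTheory.Sequence.IsRegular N rs}) (by
      change moduleDepth R N < ⊤
      rw [h]; exact ENat.natCast_lt_top r)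
  obtain ⟨rs, hl, hm, hreg⟩ := this
  refine ⟨rs, ?_, hm, hreg⟩
  change _ = moduleDepth R N at hl
  rw [h] at hl
  exact_mod_cast hl

lemma extModule_equiv (j : ℕ) (X Y : Type) [AddCommGroup X] [Module R X] [AddCommGroup Y]
    [Module R Y] : Nonempty (extModule R j X Y ≃ₗ[R] EE R X Y j) := by
  obtain ⟨e, -⟩ := exists_bridge (R := R) (ModuleCat.of R Y) j
  exact ⟨e (ModuleCat.of R X)⟩

lemma dim_le_of_ann {K N : Type} [AddCommGroup N] [Module R N] [AddCommGroup K] [Module R K]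
    [Module.Finite R K] [Module.Finite R N]
    (h : Module.annihilator R N ≤ Module.annihilator R K) :
    Module.supportDim R K ≤ Module.supportDim R N := by
  have hs : Module.support R K ⊆ Module.support R N := by
    rw [Module.support_eq_zeroLocus, Module.support_eq_zeroLocus]
    exact PrimeSpectrum.zeroLocus_anti_mono h
  exact Order.krullDim_le_of_strictMono (Set.inclusion hs) (fun _ _ h => h)

lemma ext_dim_le [IsNoetherianRing R] {N L : Type} [AddCommGroup N] [Module R N]
    [Module.Finite R N] [AddCommGroup L] [Module R L] [Module.Finite R L] (j : ℕ) :
    Module.supportDim R (EE R N L j) ≤ Module.supportDim R N := by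
  have : Module.Finite R (EE R N L j) := inferInstance
  refine dim_le_of_ann fun r hr => ?_
  rw [Module.mem_annihilator] at hr ⊢
  exact fun a => smul_eq_zero_of_ann_left (X := ModuleCat.of R N) hr a

/-- M' has a regular sequence of length d -/
lemma Mprime_regular [IsNoetherianRing R] {n d : ℕ} (hdim : ringKrullDim R = n)
    (hk : ∀ j ≠ n, Subsingleton (EE R (R ⧸ maximalIdeal R) R j)) (hdn : d ≤ n)
    (K : Type) [AddCommGroup K] [Module R K] [Module.Finite R K] [Nontrivial K]
    (hKd : Module.supportDim R K ≤ d) (hCM : IsCM R K)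
    (hnt : Nontrivial (EE R K R (n - d))) :
    ∃ rs : List R, rs.length = d ∧ (∀ x ∈ rs, x ∈ maximalIdeal R) ∧
      IsWeaklyRegular (EE R K R (n-d)) rs := by
  obtain ⟨e, he, hed⟩ := dim_eq_coe hKd
  have hde : e = d := by
    by_contra hne
    have := ischebeck R n (fun j hj => hk j (by omega)) e K he.le (n-d) (by omega)
    exact not_subsingleton _ this
  subst hde
  rcases hCM with h | h
  · exact absurd h (not_subsingleton K)
  · have h' : moduleDepth R K = e := by
      have : Module.supportDim R K = (moduleDepth R K : WithBot ℕ∞) := h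
      rw [he] at this
      exact (WithBot.coe_inj.1 this).symm
    obtain ⟨rs, hl, hm, hreg⟩ := exists_regular_of_depth e h'
    refine ⟨rs, hl, hm, ?_⟩
    exact ext_regular_seq R n hdim hk rs hm K hreg.toIsWeaklyRegular (by rw [hl]; exact hKd) _
      (by omega)

end Depth
end

noncomputable section

section SerreSec

open Opposite IsLocalRing RingTheory.Sequence
open scoped Pointwise

variable {A : Type} [CommRing A]

lemma dim_loc_add_le {M : Type} [AddCommGroup M] [Module A M] [Module.Finite A M]
    (P : Ideal A) [P.IsPrime] (hP : Module.annihilator A M ≤ P) :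
    Module.supportDim (Localization.AtPrime P) (LocalizedModule P.primeCompl M) +
      ringKrullDim (A ⧸ P) ≤ Module.supportDim A M := by
  have hmem : (⟨P, inferInstance⟩ : PrimeSpectrum A) ∈ Module.support A M := by
    rw [Module.support_eq_zeroLocus]; exact hP
  let p : Module.support A M := ⟨⟨P, inferInstance⟩, hmem⟩
  have h1 : Module.supportDim (Localization.AtPrime P) (LocalizedModule P.primeCompl M) ≤
      Order.height p := by
    rw [Order.height_eq_krullDim_Iic]
    have key : ∀ q ∈ Module.support (Localization.AtPrime P) (LocalizedModule P.primeCompl M),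
        PrimeSpectrum.comap (algebraMap A (Localization.AtPrime P)) q ∈ Module.support A M := by
      intro q hq
      rw [Module.support_eq_zeroLocus] at hq ⊢
      intro r hr
      refine hq ?_
      rw [SetLike.mem_coe, Module.mem_annihilator] at hr ⊢
      intro m
      induction m using LocalizedModule.induction_on with
      | _ m s =>
      rw [algebraMap_smul, LocalizedModule.smul'_mk, hr, LocalizedModule.zero_mk]
    let F : Module.support (Localization.AtPrime P) (LocalizedModule P.primeCompl M) → Set.Iic p :=
      fun q => ⟨⟨PrimeSpectrum.comap (algebraMap A (Localization.AtPrime P)) q.1, key q.1 q.2⟩, by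
        have : (PrimeSpectrum.comap (algebraMap A (Localization.AtPrime P)) q.1).asIdeal ≤ P := by
          have h := le_maximalIdeal q.1.2.ne_top
          have := Ideal.comap_mono (f := algebraMap A (Localization.AtPrime P)) h
          exact this.trans (Localization.AtPrime.under_maximalIdeal (I := P)).le
        exact this⟩
    refine Order.krullDim_le_of_strictMono F ?_
    refine Monotone.strictMono_of_injective ?_ ?_
    · intro a b h
      exact Ideal.comap_mono (f := algebraMap A (Localization.AtPrime P)) h
    · intro a b h
      have h2 : PrimeSpectrum.comap (algebraMap A (Localization.AtPrime P)) a.1 =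
        PrimeSpectrum.comap (algebraMap A (Localization.AtPrime P)) b.1 :=
        congrArg (fun x => x.1.1) h
      exact Subtype.ext (PrimeSpectrum.localization_comap_injective _ P.primeCompl h2)
  have h2 : ringKrullDim (A ⧸ P) ≤ Order.coheight p := by
    rw [Order.coheight_eq_krullDim_Ici]
    have hle : ∀ q : PrimeSpectrum (A ⧸ P), P ≤ (PrimeSpectrum.comap (Ideal.Quotient.mk P) q).asIdeal := by
      intro q r hr
      change Ideal.Quotient.mk P r ∈ q.asIdeal
      rw [Ideal.Quotient.eq_zero_iff_mem.2 hr]; exact zero_mem _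
    let F : PrimeSpectrum (A ⧸ P) → Set.Ici p := fun q =>
      ⟨⟨PrimeSpectrum.comap (Ideal.Quotient.mk P) q, by
        rw [Module.support_eq_zeroLocus]; exact hP.trans (hle q)⟩, hle q⟩
    refine Order.krullDim_le_of_strictMono F ?_
    refine Monotone.strictMono_of_injective ?_ ?_
    · intro a b h
      exact Ideal.comap_mono (f := Ideal.Quotient.mk P) h
    · intro a b h
      have h2 : PrimeSpectrum.comap (Ideal.Quotient.mk P) a =
        PrimeSpectrum.comap (Ideal.Quotient.mk P) b := congrArg (fun x => x.1.1) h
      exact PrimeSpectrum.comap_injective_of_surjective _ Ideal.Quotient.mk_surjective h2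
  refine (add_le_add h1 h2).trans ?_
  have : Nonempty (Module.support A M) := ⟨p⟩
  rw [Module.supportDim, Order.krullDim_eq_iSup_height_add_coheight_of_nonempty, ← WithBot.coe_add,
    WithBot.coe_le_coe]
  exact le_iSup (fun a : Module.support A M => Order.height a + Order.coheight a) p

variable [IsNoetherianRing A] [IsLocalRing A]

lemma serre_of_regular {M : Type} [AddCommGroup M] [Module A M] [Module.Finite A M] {d : ℕ}
    (hd : Module.supportDim A M = d) (rs : List A) (hl : rs.length = d)
    (hm : ∀ x ∈ rs, x ∈ maximalIdeal A) (hreg : IsWeaklyRegular M rs) : SerreS2 A M := by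
  intro P hPp
  by_cases hnt : Subsingleton (LocalizedModule P.primeCompl M)
  · have : moduleDim (Localization.AtPrime P) (LocalizedModule P.primeCompl M) = ⊥ :=
      Module.supportDim_eq_bot_of_subsingleton _ _
    rw [this]; exact (min_le_right _ _).trans bot_le
  rw [not_subsingleton_iff_nontrivial] at hnt
  have hP : Module.annihilator A M ≤ P := by
    have : (⟨P, hPp⟩ : PrimeSpectrum A) ∈ Module.support A M := hnt
    rw [Module.support_eq_zeroLocus] at this
    exact this
  have hntM : Nontrivial M := by
    rw [← Module.supportDim_ne_bot_iff_nontrivial A, hd]; exact WithBot.coe_ne_bot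
  have hk := ext_of_regular rs hm (IsRegular.of_isWeaklyRegular_of_mem_maximalIdeal M hm hreg)
  have h0 := dim_loc_add_le P hP
  rw [hd] at h0
  have hPd : Module.supportDim A (A ⧸ P) ≤ d := by
    rw [← hd]
    exact dim_le_of_ann (by rwa [Ideal.annihilator_quotient])
  have : Nontrivial (A ⧸ P) := Ideal.Quotient.nontrivial_iff.2 hPp.ne_top
  obtain ⟨c, hc, hcd⟩ := dim_eq_coe hPd
  obtain ⟨ss, hsl, hsP, hsreg⟩ := exists_regular_of_ext (N := M) P hPp.ne_top (d - c)
    (fun j hj => ischebeck M d (hl ▸ hk) c (A ⧸ P) hc.le j (by omega))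
  have hloc := IsWeaklyRegular.isRegular_of_isLocalizedModule_of_mem (Localization.AtPrime P) P
    (LocalizedModule.mkLinearMap P.primeCompl M) hsreg.toIsWeaklyRegular hsP
  have hdepth : ((d - c : ℕ) : ℕ∞) ≤ moduleDepth (Localization.AtPrime P) (LocalizedModule P.primeCompl M) := by
    refine le_sSup ⟨_, ?_, ?_, hloc⟩
    · rw [List.length_map, hsl]
    · intro r hr
      obtain ⟨x, hx, rfl⟩ := List.mem_map.1 hr
      exact (IsLocalization.AtPrime.to_map_mem_maximal_iff (Localization.AtPrime P) P x).2 (hsP x hx)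
  refine (min_le_right _ _).trans (le_trans ?_ (WithBot.coe_le_coe.2 hdepth))
  rw [Module.supportDim_quotient_eq_ringKrullDim] at hc
  rw [hc] at h0
  change Module.supportDim _ _ ≤ _
  generalize Module.supportDim (Localization.AtPrime P) (LocalizedModule P.primeCompl M) = D at h0 ⊢
  induction D with
  | bot => exact bot_le
  | coe D =>
    have h : (D : WithBot ℕ∞) + ((c:ℕ∞):WithBot ℕ∞) ≤ ((d:ℕ∞):WithBot ℕ∞) := h0
    rw [← WithBot.coe_add, WithBot.coe_le_coe] at h
    refine WithBot.coe_le_coe.2 ?_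
    induction D with
    | top => simp at h
    | coe D =>
      have h : D + c ≤ d := by exact_mod_cast h
      have : D ≤ d - c := by omega
      exact_mod_cast this

lemma serre_of_dim_le_one {M : Type} [AddCommGroup M] [Module A M] [Module.Finite A M] {d : ℕ}
    (hd : Module.supportDim A M = d) (hd1 : d ≤ 1) (hun : IsUnmixed A M) : SerreS2 A M := by
  obtain rfl | rfl : d = 0 ∨ d = 1 := by omega
  · exact serre_of_regular hd [] rfl (by simp) (IsWeaklyRegular.nil A M)
  · by_cases h : Subsingleton ((A ⧸ maximalIdeal A) →ₗ[A] M)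
    · obtain ⟨x, hx, hr⟩ := IsSMulRegular.subsingleton_linearMap_iff.1 h
      rw [Ideal.annihilator_quotient] at hx
      refine serre_of_regular hd [x] rfl (by simpa using hx) ?_
      rw [isWeaklyRegular_cons_iff]
      exact ⟨hr, IsWeaklyRegular.nil _ _⟩
    · exfalso
      obtain ⟨f, hf⟩ : ∃ f : (A ⧸ maximalIdeal A) →ₗ[A] M, f ≠ 0 := by
        by_contra! hc
        exact h ⟨fun a b => by rw [hc a, hc b]⟩
      have : IsSimpleModule A (A ⧸ maximalIdeal A) := by
        rw [isSimpleModule_iff_isCoatom]; exact (maximalIdeal.isMaximal A).out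
      have hinj : Function.Injective f := (LinearMap.injective_or_eq_zero f).resolve_right hf
      have hass := associatedPrimes.subset_of_injective hinj
      have hm : maximalIdeal A ∈ associatedPrimes A (A ⧸ maximalIdeal A) := by
        obtain ⟨q, hq⟩ := associatedPrimes.nonempty A (A ⧸ maximalIdeal A)
        have h1 : maximalIdeal A ≤ q := by
          have := hq.annihilator_le
          rwa [Submodule.annihilator_top, Ideal.annihilator_quotient] at this
        have h4 := (maximalIdeal.isMaximal A).eq_of_le hq.1.ne_top h1
        exact h4.symm ▸ hq
      have h2 := hun _ (hass hm)
      change _ = Module.supportDim A M at h2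
      rw [hd] at h2
      have h3 : ringKrullDim (A ⧸ maximalIdeal A) = 0 :=
        letI := Ideal.Quotient.field (maximalIdeal A)
        ringKrullDim_eq_zero_of_field _
      rw [h3] at h2
      exact absurd h2 (by decide)

end SerreSec
end

noncomputable section

section Transfer

open Opposite IsLocalRing RingTheory.Sequence
open scoped Pointwise

variable {R : Type} [CommRing R] [IsLocalRing R] {A : Type} [CommRing A] [IsLocalRing A]
  [Algebra R A] (hsurj : Function.Surjective (algebraMap R A))
  {M : Type} [AddCommGroup M] [Module A M] [Module R M] [IsScalarTower R A M]

include hsurj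

omit [IsLocalRing R] [IsLocalRing A] in
lemma finite_transfer [Module.Finite A M] : Module.Finite R M := by
  have : Module.Finite R A := Module.Finite.of_surjective (Algebra.linearMap R A) hsurj
  exact Module.Finite.trans A M

omit [IsLocalRing R] [IsLocalRing A] in
lemma dim_transfer [Module.Finite A M] : Module.supportDim R M = Module.supportDim A M := by
  have := finite_transfer hsurj (M := M)
  rw [Module.supportDim_eq_ringKrullDim_quotient_annihilator,
    Module.supportDim_eq_ringKrullDim_quotient_annihilator]
  have hI : Module.annihilator A M = (Module.annihilator R M).map (algebraMap R A) := by
    rw [← Module.comap_annihilator (R₀ := R) (R := A) (M := M), Ideal.map_comap_of_surjective _ hsurj]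
  have hker : Module.annihilator R M =
      RingHom.ker ((Ideal.Quotient.mk (Module.annihilator A M)).comp (algebraMap R A)) := by
    rw [← RingHom.comap_ker, Ideal.mk_ker, Module.comap_annihilator]
  have hs : Function.Surjective ((Ideal.Quotient.mk (Module.annihilator A M)).comp (algebraMap R A)) :=
    Ideal.Quotient.mk_surjective.comp hsurj
  rw [hker]
  exact ringKrullDim_eq_of_ringEquiv (RingHom.quotientKerEquivOfSurjective hs)

lemma mem_max_iff (r : R) : algebraMap R A r ∈ maximalIdeal A ↔ r ∈ maximalIdeal R := by
  have : IsLocalHom (algebraMap R A) := hsurj.isLocalHom _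
  rw [mem_maximalIdeal, mem_maximalIdeal, mem_nonunits_iff, mem_nonunits_iff,
    isUnit_map_iff]

lemma depth_transfer [Module.Finite A M] [Nontrivial M] : moduleDepth A M = moduleDepth R M := by
  have := finite_transfer hsurj (M := M)
  unfold moduleDepth
  congr 1
  ext n
  constructor
  · rintro ⟨rs, rfl, hm, hreg⟩
    obtain ⟨ss, rfl⟩ := hsurj.list_map rs
    have hm' : ∀ r ∈ ss, r ∈ maximalIdeal R := fun r hr =>
      (mem_max_iff hsurj r).1 (hm _ (List.mem_map_of_mem hr))
    refine ⟨ss, by simp, hm', ?_⟩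
    exact IsRegular.of_isWeaklyRegular_of_mem_maximalIdeal M hm'
      ((isWeaklyRegular_map_algebraMap_iff A M ss).1 hreg.toIsWeaklyRegular)
  · rintro ⟨ss, rfl, hm, hreg⟩
    have hm' : ∀ r ∈ ss.map (algebraMap R A), r ∈ maximalIdeal A := by
      intro r hr
      obtain ⟨x, hx, rfl⟩ := List.mem_map.1 hr
      exact (mem_max_iff hsurj x).2 (hm x hx)
    refine ⟨ss.map (algebraMap R A), by simp, hm', ?_⟩
    exact IsRegular.of_isWeaklyRegular_of_mem_maximalIdeal M hm'
      ((isWeaklyRegular_map_algebraMap_iff A M ss).2 hreg.toIsWeaklyRegular)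

end Transfer

section Core

open Opposite IsLocalRing RingTheory.Sequence
open scoped Pointwise

variable {R : Type} [CommRing R] [IsLocalRing R] [IsNoetherianRing R]

lemma exists_ext_ne_zero (N : Type) [AddCommGroup N] [Module R N] [Module.Finite R N] [Nontrivial N]
    {e : ℕ} (he : Module.supportDim R N ≤ e) :
    ∃ j ≤ e, ¬ Subsingleton (EE R (R ⧸ maximalIdeal R) N j) := by
  by_contra! hc
  have := ischebeck N (e+1) (fun j hj => hc j (by omega)) e N he 0 (by omega)
  have h1 : Subsingleton (ModuleCat.of R N ⟶ ModuleCat.of R N) :=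
    Abelian.Ext.addEquiv₀.subsingleton_congr.mp this
  have h2 : 𝟙 (ModuleCat.of R N) = 0 := Subsingleton.elim _ _
  obtain ⟨x, hx⟩ := exists_ne (0 : N)
  exact hx (ConcreteCategory.congr_hom h2 x)

omit [IsLocalRing R] [IsNoetherianRing R] in
lemma co_left_zero {S : ShortComplex (ModuleCat.{0} R)} (hS : S.ShortExact) (W : ModuleCat.{0} R)
    (h : Subsingleton (Abelian.Ext W S.X₂ 0)) : Subsingleton (Abelian.Ext W S.X₁ 0) := by
  rw [Ext_subsingleton_iff]
  intro a
  obtain ⟨f, rfl⟩ := (Abelian.Ext.mk₀_bijective _ _).2 a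
  have h1 : Abelian.Ext.mk₀ (f ≫ S.f) = 0 := Subsingleton.elim _ _
  rw [← Abelian.Ext.mk₀_zero] at h1
  have h2 := (Abelian.Ext.mk₀_bijective _ _).1 h1
  have := hS.mono_f
  rw [Limits.zero_of_comp_mono S.f h2, Abelian.Ext.mk₀_zero]

lemma core {n d : ℕ} (hdim : ringKrullDim R = n)
    (hk : ∀ j ≠ n, Subsingleton (EE R (R ⧸ maximalIdeal R) R j)) (hd2 : 2 ≤ d)
    (M M' : Type) [AddCommGroup M] [Module R M] [Module.Finite R M] [Nontrivial M]
    [AddCommGroup M'] [Module R M'] [Module.Finite R M']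
    (ι : M →ₗ[R] M') (hι : Function.Injective ι)
    (hns : ¬ Function.Surjective ι)
    (hcoker : Module.supportDim R (M' ⧸ LinearMap.range ι) ≤ (d - 2 : ℕ))
    (hM' : ∀ j < d, Subsingleton (EE R (R ⧸ maximalIdeal R) M' j)) :
    (∀ i : ℕ, 1 ≤ i → i ≤ d - 1 →
      Nonempty ((localCohomology (IsLocalRing.maximalIdeal R) (i - 1)).obj
          (ModuleCat.of R (M' ⧸ LinearMap.range ι)) ≅
        (localCohomology (IsLocalRing.maximalIdeal R) i).obj (ModuleCat.of R M))) ∧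
    moduleDepth R (M' ⧸ LinearMap.range ι) = moduleDepth R M - 1 ∧
    moduleDim R (M' ⧸ LinearMap.range ι) =
      ((sSup {i : ℕ | i ≤ d - 2 ∧
          ¬ Subsingleton ↥((localCohomology (IsLocalRing.maximalIdeal R) (i + 1)).obj
              (ModuleCat.of R M))} : ℕ) : WithBot ℕ∞) := by
  have hex : Function.Exact ι (LinearMap.range ι).mkQ := by
    rw [LinearMap.exact_iff]; simp
  have hS := sC_exact ι (LinearMap.range ι).mkQ hex hι (Submodule.mkQ_surjective _)
  have hNnt : Nontrivial (M' ⧸ LinearMap.range ι) := by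
    rw [Submodule.Quotient.nontrivial_iff]
    rwa [Ne, LinearMap.range_eq_top]
  have hiso : ∀ i : ℕ, i + 1 < d → Nonempty ((localCohomology (IsLocalRing.maximalIdeal R) i).obj
          (ModuleCat.of R (M' ⧸ LinearMap.range ι)) ≅
        (localCohomology (IsLocalRing.maximalIdeal R) (i+1)).obj (ModuleCat.of R M)) := by
    intro i hi
    have : Module.Finite R (sC ι (LinearMap.range ι).mkQ hex).X₂ := inferInstanceAs (Module.Finite R M')
    exact lc_iso_conn hS d hM' i hi
  obtain ⟨e, he, hed⟩ := dim_eq_coe hcoker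
  refine ⟨?_, ?_, ?_⟩
  · intro i h1 h2
    obtain ⟨i, rfl⟩ : ∃ i', i = i' + 1 := ⟨i - 1, by omega⟩
    exact hiso i (by omega)
  · classical
    have hexj := exists_ext_ne_zero (M' ⧸ LinearMap.range ι) he.le
    have hexj' : ∃ j, ¬ Subsingleton (EE R (R ⧸ maximalIdeal R) (M' ⧸ LinearMap.range ι) j) := by
      obtain ⟨j, -, h⟩ := hexj; exact ⟨j, h⟩
    obtain ⟨j0, h0, hmin⟩ : ∃ j0, ¬ Subsingleton (EE R (R ⧸ maximalIdeal R) (M' ⧸ LinearMap.range ι) j0) ∧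
        ∀ j < j0, Subsingleton (EE R (R ⧸ maximalIdeal R) (M' ⧸ LinearMap.range ι) j) :=
      ⟨Nat.find hexj', Nat.find_spec hexj', fun j hj => not_not.1 (Nat.find_min hexj' hj)⟩
    have hj0 : j0 ≤ e := by
      obtain ⟨j, hj, h⟩ := hexj
      by_contra hc
      exact h (hmin j (by omega))
    have hN := depth_eq j0 hmin h0
    have hM : moduleDepth R M = ((j0 + 1 : ℕ) : ℕ∞) := by
      refine depth_eq (j0+1) ?_ ?_
      · intro j hj
        rcases j with _ | j
        · exact co_left_zero hS _ (hM' 0 (by omega))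
        · exact co_left hS _ (hmin j (by omega)) (hM' (j+1) (by omega))
      · intro hc
        refine h0 ?_
        exact (connEquiv hS _ j0 (hM' j0 (by omega)) (hM' (j0+1) (by omega))).toEquiv.subsingleton_congr.2 hc
    rw [hN, hM]
    exact_mod_cast rfl
  · have hset : ∀ i, i ≤ d - 2 → (¬ Subsingleton ↥((localCohomology (IsLocalRing.maximalIdeal R) (i + 1)).obj
              (ModuleCat.of R M)) ↔ ¬ EZ (maximalIdeal R) i (ModuleCat.of R (M' ⧸ LinearMap.range ι))) := by
      intro i hi
      obtain ⟨α⟩ := hiso i (by omega)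
      rw [← lc_subsingleton_iff, α.toLinearEquiv.toEquiv.subsingleton_congr]
    have hmax : IsGreatest {i : ℕ | i ≤ d - 2 ∧
          ¬ Subsingleton ↥((localCohomology (IsLocalRing.maximalIdeal R) (i + 1)).obj
              (ModuleCat.of R M))} e := by
      constructor
      · exact ⟨hed, (hset e hed).2 (EZ_nonvanish hdim hk _ he)⟩
      · rintro i ⟨hi, h⟩
        by_contra hc
        exact (hset i hi).1 h (EZ_vanish e _ he.le i (by omega))
    rw [hmax.csSup_eq]
    exact he

end Core
end

/-- if `K_M` is Cohen–Macaulay then `H^{i-1}_m(M'/M) ≅ H^i_m(M)` for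
`1 ≤ i ≤ d-1`; in particular `depth(M'/M) = depth M - 1` and
`dim(M'/M) = max{ i ≤ d-2 : H^{i+1}_m(M) ≠ 0 }`. -/
theorem stmt_5
    (R : Type) [CommRing R] [IsLocalRing R] (hGor : IsGorensteinLocalRing R)
    (n : ℕ) (hn : ringKrullDim R = n)
    (A : Type) [CommRing A] [IsLocalRing A] [IsNoetherianRing A]
    (π : R →+* A) (hπ : Function.Surjective π)
    (M : Type) [AddCommGroup M] [Module A M] [Module R M] [Module.Finite A M]
    (hcompat : ∀ (r : R) (m : M), π r • m = r • m)
    (d : ℕ) (hd : moduleDim A M = d)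
    (hunmixed : IsUnmixed A M) (hnotS2 : ¬ SerreS2 A M)
    -- the natural inclusion of `M` into its `S_2`-fication `M' = D^d(D^d(M))`
    (ι : M →ₗ[R] ↥(extModule R (n - d) (↥(extModule R (n - d) M R)) R))
    (hι : Function.Injective ι)
    (hcoker : moduleDim R
      (↥(extModule R (n - d) (↥(extModule R (n - d) M R)) R) ⧸ LinearMap.range ι) ≤
        ((d - 2 : ℕ) : WithBot ℕ∞))
    (hKM : IsCM R ↥(extModule R (n - d) M R)) :
    (∀ i : ℕ, 1 ≤ i → i ≤ d - 1 →
      Nonempty ((localCohomology (IsLocalRing.maximalIdeal R) (i - 1)).obj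
          (ModuleCat.of R
            (↥(extModule R (n - d) (↥(extModule R (n - d) M R)) R) ⧸ LinearMap.range ι)) ≅
        (localCohomology (IsLocalRing.maximalIdeal R) i).obj (ModuleCat.of R M))) ∧
    moduleDepth R
        (↥(extModule R (n - d) (↥(extModule R (n - d) M R)) R) ⧸ LinearMap.range ι) =
      moduleDepth A M - 1 ∧
    moduleDim R
        (↥(extModule R (n - d) (↥(extModule R (n - d) M R)) R) ⧸ LinearMap.range ι) =
      ((sSup {i : ℕ | i ≤ d - 2 ∧
          ¬ Subsingleton ↥((localCohomology (IsLocalRing.maximalIdeal R) (i + 1)).obj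
              (ModuleCat.of R M))} : ℕ) : WithBot ℕ∞) := by
  have : IsNoetherianRing R := hGor.1
  have hk : ∀ j ≠ n, Subsingleton (EE R (R ⧸ IsLocalRing.maximalIdeal R) R j) := by
    intro j hj
    obtain ⟨e⟩ := extModule_equiv (R := R) j (IsLocalRing.ResidueField R) R
    have := (hGor.2 n hn).1 j hj
    exact e.symm.toEquiv.subsingleton
  let : Algebra R A := π.toAlgebra
  have hsurj : Function.Surjective (algebraMap R A) := hπ
  have : IsScalarTower R A M := IsScalarTower.of_algebraMap_smul hcompat
  have hfM : Module.Finite R M := finite_transfer hsurj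
  have hdA : Module.supportDim A M = d := hd
  have hntM : Nontrivial M := by
    by_contra h
    rw [not_nontrivial_iff_subsingleton] at h
    rw [Module.supportDim_eq_bot_of_subsingleton] at hdA
    exact absurd hdA (by simp)
  have hdR : Module.supportDim R M = d := (dim_transfer hsurj).trans hdA
  have hdn : d ≤ n := by
    have h := Module.supportDim_le_ringKrullDim R M
    rw [hdR, hn] at h
    exact_mod_cast h
  obtain ⟨eK⟩ := extModule_equiv (R := R) (n - d) M R
  have hfK : Module.Finite R ↥(extModule R (n - d) M R) := Module.Finite.equiv eK.symm
  have hKd : Module.supportDim R ↥(extModule R (n - d) M R) ≤ d := by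
    rw [Module.supportDim_eq_of_equiv eK, ← hdR]
    exact ext_dim_le (n - d)
  obtain ⟨eM⟩ := extModule_equiv (R := R) (n - d) ↥(extModule R (n - d) M R) R
  have hfM' : Module.Finite R ↥(extModule R (n - d) ↥(extModule R (n - d) M R) R) :=
    Module.Finite.equiv eM.symm
  have hntM' : Nontrivial ↥(extModule R (n - d) ↥(extModule R (n - d) M R) R) := hι.nontrivial
  have hntE : Nontrivial (EE R ↥(extModule R (n - d) M R) R (n - d)) := eM.symm.toEquiv.nontrivial
  have hntK : Nontrivial ↥(extModule R (n - d) M R) := by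
    by_contra h
    rw [not_nontrivial_iff_subsingleton] at h
    exact not_subsingleton _ (EE_of_subsingleton_left (R := R) (L := R) (j := n - d)
      (X := ↥(extModule R (n - d) M R)))
  obtain ⟨rs, hl, hm, hreg⟩ := Mprime_regular hn hk hdn _ hKd hKM hntE
  have hreg' : RingTheory.Sequence.IsWeaklyRegular
      ↥(extModule R (n - d) ↥(extModule R (n - d) M R) R) rs :=
    (eM.isWeaklyRegular_congr rs).2 hreg
  have hM' : ∀ j < d, Subsingleton (EE R (R ⧸ IsLocalRing.maximalIdeal R)
      ↥(extModule R (n - d) ↥(extModule R (n - d) M R) R) j) := by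
    intro j hj
    exact ext_of_regular rs hm
      (RingTheory.Sequence.IsRegular.of_isWeaklyRegular_of_mem_maximalIdeal _ hm hreg') j
      (by rw [hl]; exact hj)
  have hd2 : 2 ≤ d := by
    by_contra h
    exact hnotS2 (serre_of_dim_le_one hdA (by omega) hunmixed)
  have hns : ¬ Function.Surjective ι := by
    intro hs
    have hregM : RingTheory.Sequence.IsWeaklyRegular M rs :=
      ((LinearEquiv.ofBijective ι ⟨hι, hs⟩).isWeaklyRegular_congr rs).2 hreg'
    refine hnotS2 (serre_of_regular hdA (rs.map (algebraMap R A)) (by simp [hl]) ?_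
      ((RingTheory.Sequence.isWeaklyRegular_map_algebraMap_iff A M rs).2 hregM))
    intro r hr
    obtain ⟨x, hx, rfl⟩ := List.mem_map.1 hr
    exact (mem_max_iff hsurj x).2 (hm x hx)
  rw [depth_transfer hsurj]
  exact core hn hk hd2 M _ ι hι hns hcoker hM'
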